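/- arXiv:1203.3691 — 3 statements merged into one kernel-verified Lean document; each statement's English description precedes it below -/
import Mathlib

section
/- Let d ≥ 3 and let ℓ₁,…,ℓ_d : ℝ² → ℝ be affine-linear functions defining d pairwise distinct lines that form a simple arrangement (no two of the lines are parallel and no three pass through a common point). Let f = ℓ₁·ℓ₂·⋯·ℓ_d. Then every critical point of f is non-degenerate (the Hessian determinant of f is nonzero at every point where the gradient of f vanishes), and the number of critical points p of f with f(p) ≠ 0 is exactly binom(d−1, 2). -/
noncomputable section

/-- Partial derivative in the first variable. -/
def pdx (f : ℝ × ℝ → ℝ) (p : ℝ × ℝ) : ℝ := deriv (fun t => f (t, p.2)) p.1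

/-- Partial derivative in the second variable. -/
def pdy (f : ℝ × ℝ → ℝ) (p : ℝ × ℝ) : ℝ := deriv (fun t => f (p.1, t)) p.2

/-- Determinant of the Hessian matrix of `f` at `p`. -/
def hessDet2 (f : ℝ × ℝ → ℝ) (p : ℝ × ℝ) : ℝ :=
  pdx (pdx f) p * pdy (pdy f) p - pdx (pdy f) p * pdy (pdx f) p


namespace SA

/-- the affine form -/
def L {d : ℕ} (a b c : Fin d → ℝ) (i : Fin d) (p : ℝ × ℝ) : ℝ := a i * p.1 + b i * p.2 + c i

/-- two by two minor -/
def D {d : ℕ} (a b : Fin d → ℝ) (i j : Fin d) : ℝ := a i * b j - a j * b i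

lemma hasDeriv {d : ℕ} (m n : Fin d → ℝ) (s : Finset (Fin d)) (x : ℝ) :
    HasDerivAt (fun t => ∏ i ∈ s, (m i * t + n i))
      (∑ i ∈ s, m i * ∏ j ∈ s.erase i, (m j * x + n j)) x := by
  have h := HasDerivAt.fun_finsetProd (u := s) (f := fun i t => m i * t + n i) (f' := m) (x := x)
    (fun i _ => by simpa using ((hasDerivAt_id x).const_mul (m i)).add_const (n i))
  refine h.congr_deriv ?_
  refine Finset.sum_congr rfl fun i _ => ?_
  simp [mul_comm]

variable {d : ℕ} (a b c : Fin d → ℝ)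

lemma hdx (s : Finset (Fin d)) (p : ℝ × ℝ) :
    HasDerivAt (fun t => ∏ i ∈ s, L a b c i (t, p.2))
      (∑ i ∈ s, a i * ∏ j ∈ s.erase i, L a b c j p) p.1 := by
  have h := hasDeriv a (fun i => b i * p.2 + c i) s p.1
  simpa only [L, add_assoc] using h

lemma hdy (s : Finset (Fin d)) (p : ℝ × ℝ) :
    HasDerivAt (fun t => ∏ i ∈ s, L a b c i (p.1, t))
      (∑ i ∈ s, b i * ∏ j ∈ s.erase i, L a b c j p) p.2 := by
  have h := hasDeriv b (fun i => a i * p.1 + c i) s p.2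
  have e : ∀ i t, L a b c i (p.1, t) = b i * t + (a i * p.1 + c i) := fun i t => by
    simp only [L]; ring
  have e' : ∀ i, L a b c i p = b i * p.2 + (a i * p.1 + c i) := fun i => by
    simp only [L]; ring
  simpa only [e, e'] using h

/-- product -/
def F (p : ℝ × ℝ) : ℝ := ∏ i, L a b c i p

lemma pdx_F : pdx (F a b c) = fun p => ∑ i, a i * ∏ j ∈ Finset.univ.erase i, L a b c j p := by
  funext p
  exact (hdx a b c Finset.univ p).deriv

lemma pdy_F : pdy (F a b c) = fun p => ∑ i, b i * ∏ j ∈ Finset.univ.erase i, L a b c j p := by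
  funext p
  exact (hdy a b c Finset.univ p).deriv

/-- second derivative sum -/
def H (u v : Fin d → ℝ) (p : ℝ × ℝ) : ℝ :=
  ∑ i, u i * ∑ j ∈ Finset.univ.erase i, v j *
    ∏ k ∈ (Finset.univ.erase i).erase j, L a b c k p

lemma pdx_sum (u : Fin d → ℝ) (p : ℝ × ℝ) :
    pdx (fun p => ∑ i, u i * ∏ j ∈ Finset.univ.erase i, L a b c j p) p = H a b c u a p := by
  have h := HasDerivAt.fun_sum (u := (Finset.univ : Finset (Fin d)))
    (fun i _ => (hdx a b c (Finset.univ.erase i) p).const_mul (u i))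
  exact h.deriv

lemma pdy_sum (u : Fin d → ℝ) (p : ℝ × ℝ) :
    pdy (fun p => ∑ i, u i * ∏ j ∈ Finset.univ.erase i, L a b c j p) p = H a b c u b p := by
  have h := HasDerivAt.fun_sum (u := (Finset.univ : Finset (Fin d)))
    (fun i _ => (hdy a b c (Finset.univ.erase i) p).const_mul (u i))
  exact h.deriv

lemma hess_F (p : ℝ × ℝ) : hessDet2 (F a b c) p =
    H a b c a a p * H a b c b b p - H a b c b a p * H a b c a b p := by
  unfold hessDet2
  rw [pdx_F, pdy_F, pdx_sum, pdy_sum, pdx_sum, pdy_sum]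

lemma grad_sum (u : Fin d → ℝ) (p : ℝ × ℝ) (hp : ∀ i, L a b c i p ≠ 0) :
    ∑ i, u i * ∏ j ∈ Finset.univ.erase i, L a b c j p = F a b c p * ∑ i, u i / L a b c i p := by
  rw [Finset.mul_sum]
  refine Finset.sum_congr rfl fun i _ => ?_
  have := Finset.mul_prod_erase Finset.univ (fun j => L a b c j p) (Finset.mem_univ i)
  rw [F, ← this]
  field_simp [hp i]

lemma H_off (u v : Fin d → ℝ) (p : ℝ × ℝ) (hp : ∀ i, L a b c i p ≠ 0) :
    H a b c u v p = F a b c p * ((∑ i, u i / L a b c i p) * (∑ i, v i / L a b c i p)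
      - ∑ i, (u i / L a b c i p) * (v i / L a b c i p)) := by
  have key : ∀ i, u i * ∑ j ∈ Finset.univ.erase i, v j *
      ∏ k ∈ (Finset.univ.erase i).erase j, L a b c k p =
      F a b c p * (u i / L a b c i p * (∑ j, v j / L a b c j p)
        - (u i / L a b c i p) * (v i / L a b c i p)) := by
    intro i
    rw [← mul_sub, ← Finset.add_sum_erase Finset.univ (fun j => v j / L a b c j p)
      (Finset.mem_univ i), add_sub_cancel_left, Finset.mul_sum, Finset.mul_sum, Finset.mul_sum]
    refine Finset.sum_congr rfl fun j hj => ?_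
    have h1 := Finset.mul_prod_erase Finset.univ (fun j => L a b c j p) (Finset.mem_univ i)
    have h2 := Finset.mul_prod_erase (Finset.univ.erase i) (fun j => L a b c j p) hj
    rw [F, ← h1, ← h2]
    have := hp i
    have := hp j
    field_simp
  unfold H
  rw [Finset.sum_congr rfl fun i _ => key i, ← Finset.mul_sum, Finset.sum_sub_distrib,
    Finset.sum_mul]

lemma lagrange (α β : Fin d → ℝ) : ∑ i, ∑ j, (α i * β j - α j * β i) ^ 2 =
    2 * ((∑ i, α i * α i) * (∑ i, β i * β i) - (∑ i, α i * β i) * (∑ i, α i * β i)) := by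
  have : ∀ i j, (α i * β j - α j * β i) ^ 2 = (α i * α i) * (β j * β j) +
    (β i * β i) * (α j * α j) - 2 * ((α i * β i) * (α j * β j)) := fun i j => by ring
  simp only [this, Finset.sum_sub_distrib, Finset.sum_add_distrib, ← Finset.mul_sum,
    ← Finset.sum_mul]
  ring

variable {a b c}

lemma nondeg_off (hs : ∀ i j, i ≠ j → D a b i j ≠ 0) (i j : Fin d) (hij : i ≠ j) (p : ℝ × ℝ)
    (hp : ∀ i, L a b c i p ≠ 0) (ha : ∑ i, a i / L a b c i p = 0)
    (hb : ∑ i, b i / L a b c i p = 0) : hessDet2 (F a b c) p ≠ 0 := by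
  have hF : F a b c p ≠ 0 := Finset.prod_ne_zero_iff.2 fun i _ => hp i
  rw [hess_F]
  simp only [H_off _ _ _ _ _ _ hp, ha, hb]
  have hl := lagrange (fun i => a i / L a b c i p) (fun i => b i / L a b c i p)
  have hpos : 0 < ∑ m, ∑ n, ((fun i => a i / L a b c i p) m * (fun i => b i / L a b c i p) n -
      (fun i => a i / L a b c i p) n * (fun i => b i / L a b c i p) m) ^ 2 := by
    refine Finset.sum_pos' (fun m _ => Finset.sum_nonneg fun n _ => sq_nonneg _)
      ⟨i, Finset.mem_univ _, ?_⟩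
    refine Finset.sum_pos' (fun n _ => sq_nonneg _) ⟨j, Finset.mem_univ _, ?_⟩
    refine sq_pos_of_ne_zero ?_
    have h1 := hp i
    have h2 := hp j
    have : a i / L a b c i p * (b j / L a b c j p) - a j / L a b c j p * (b i / L a b c i p) =
      D a b i j / (L a b c i p * L a b c j p) := by
      unfold D; field_simp
    simp only [this]
    exact div_ne_zero (hs i j hij) (mul_ne_zero h1 h2)
  rw [hl] at hpos
  have e : ∑ i, b i / L a b c i p * (a i / L a b c i p) =
    ∑ i, a i / L a b c i p * (b i / L a b c i p) :=
    Finset.sum_congr rfl fun i _ => mul_comm _ _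
  rw [e]
  have h3 : 0 < F a b c p ^ 2 := by positivity
  have h4 := mul_pos h3 hpos
  refine ne_of_gt ?_
  nlinarith

lemma H_on (u v : Fin d → ℝ) (p : ℝ × ℝ) (i j : Fin d) (hij : i ≠ j)
    (hi : L a b c i p = 0) (hj : L a b c j p = 0) :
    H a b c u v p = (u i * v j + u j * v i) *
      ∏ k ∈ (Finset.univ.erase i).erase j, L a b c k p := by
  unfold H
  have hz : ∀ m n k, k ≠ m → k ≠ n → L a b c k p = 0 →
      ∏ k ∈ (Finset.univ.erase m).erase n, L a b c k p = 0 := fun m n k h1 h2 h3 =>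
    Finset.prod_eq_zero (i := k) (by simp [h1, h2]) h3
  have t1 : ∑ n ∈ Finset.univ.erase i, v n *
      ∏ k ∈ (Finset.univ.erase i).erase n, L a b c k p =
      v j * ∏ k ∈ (Finset.univ.erase i).erase j, L a b c k p := by
    refine Finset.sum_eq_single_of_mem j (by simp [hij.symm]) fun n _ hnj => ?_
    rw [hz i n j hij.symm (Ne.symm hnj) hj, mul_zero]
  have t2 : ∑ n ∈ Finset.univ.erase j, v n *
      ∏ k ∈ (Finset.univ.erase j).erase n, L a b c k p =
      v i * ∏ k ∈ (Finset.univ.erase i).erase j, L a b c k p := by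
    rw [Finset.erase_right_comm (a := i)]
    refine Finset.sum_eq_single_of_mem i (by simp [hij]) fun n _ hni => ?_
    rw [hz j n i hij (Ne.symm hni) hi, mul_zero]
  have t3 : ∀ m, m ≠ i ∧ m ≠ j → u m * ∑ n ∈ Finset.univ.erase m, v n *
      ∏ k ∈ (Finset.univ.erase m).erase n, L a b c k p = 0 := by
    intro m hm
    rw [Finset.sum_eq_zero, mul_zero]
    intro n hn
    by_cases h : n = i
    · rw [hz m n j hm.2.symm (h ▸ hij.symm) hj, mul_zero]
    · rw [hz m n i hm.1.symm (Ne.symm h) hi, mul_zero]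
  rw [Fintype.sum_eq_add i j hij t3, t1, t2]
  ring

lemma ab_ne (hs : ∀ i j, i ≠ j → D a b i j ≠ 0) (i j : Fin d) (hij : i ≠ j) :
    0 < a i ^ 2 + b i ^ 2 := by
  by_contra h
  have h1 : a i = 0 := by nlinarith [sq_nonneg (a i), sq_nonneg (b i)]
  have h2 : b i = 0 := by nlinarith [sq_nonneg (a i), sq_nonneg (b i)]
  exact hs i j hij (by simp [D, h1, h2])

lemma nondeg_on (hs : ∀ i j, i ≠ j → D a b i j ≠ 0) (hne : ∀ i : Fin d, ∃ j, i ≠ j)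
    (hc : ∀ i j k, i ≠ j → i ≠ k → j ≠ k → ∀ p, L a b c i p = 0 → L a b c j p = 0 →
      L a b c k p ≠ 0)
    (p : ℝ × ℝ) (i : Fin d) (hi : L a b c i p = 0)
    (hx : pdx (F a b c) p = 0) (hy : pdy (F a b c) p = 0) : hessDet2 (F a b c) p ≠ 0 := by
  by_cases h : ∃ j, i ≠ j ∧ L a b c j p = 0
  · obtain ⟨j, hij, hj⟩ := h
    rw [hess_F]
    simp only [H_on _ _ p i j hij hi hj]
    have hG : ∏ k ∈ (Finset.univ.erase i).erase j, L a b c k p ≠ 0 := by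
      refine Finset.prod_ne_zero_iff.2 fun k hk => ?_
      simp only [Finset.mem_erase, Finset.mem_univ, and_true] at hk
      exact hc i j k hij hk.2.symm hk.1.symm p hi hj
    set G := ∏ k ∈ (Finset.univ.erase i).erase j, L a b c k p
    have h1 := hs i j hij
    have : (a i * a j + a j * a i) * G * ((b i * b j + b j * b i) * G) -
        (b i * a j + b j * a i) * G * ((a i * b j + a j * b i) * G) = - (G * D a b i j) ^ 2 := by
      unfold D; ring
    rw [this]
    exact neg_ne_zero.2 (pow_ne_zero 2 (mul_ne_zero hG h1))
  · exfalso
    push Not at h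
    have hG : ∏ k ∈ Finset.univ.erase i, L a b c k p ≠ 0 := by
      refine Finset.prod_ne_zero_iff.2 fun k hk => ?_
      simp only [Finset.mem_erase, Finset.mem_univ, and_true] at hk
      exact h k hk.symm
    have key : ∀ u : Fin d → ℝ, ∑ m, u m * ∏ k ∈ Finset.univ.erase m, L a b c k p =
        u i * ∏ k ∈ Finset.univ.erase i, L a b c k p := fun u => by
      refine Finset.sum_eq_single_of_mem i (Finset.mem_univ _) fun m _ hm => ?_
      rw [Finset.prod_eq_zero (i := i) (by simp [hm.symm]) hi, mul_zero]
    rw [pdx_F] at hx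
    rw [pdy_F] at hy
    simp only [key] at hx hy
    obtain ⟨j, hj⟩ := hne i
    have h1 := ab_ne hs i j hj
    have h2 : a i = 0 := (mul_eq_zero.1 hx).resolve_right hG
    have h3 : b i = 0 := (mul_eq_zero.1 hy).resolve_right hG
    simp [h2, h3] at h1

/-- critical point off the lines -/
def Crit (a b c : Fin d → ℝ) (p : ℝ × ℝ) : Prop :=
  (∀ i, L a b c i p ≠ 0) ∧ ∑ i, a i / L a b c i p = 0 ∧ ∑ i, b i / L a b c i p = 0

lemma crit_iff (p : ℝ × ℝ) : Crit a b c p ↔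
    (pdx (F a b c) p = 0 ∧ pdy (F a b c) p = 0) ∧ F a b c p ≠ 0 := by
  have hF : F a b c p ≠ 0 ↔ ∀ i, L a b c i p ≠ 0 := by
    simp [F, Finset.prod_ne_zero_iff]
  rw [hF, pdx_F, pdy_F]
  unfold Crit
  constructor
  · rintro ⟨h, h1, h2⟩
    simp [grad_sum a b c _ p h, h1, h2, h]
  · rintro ⟨⟨h1, h2⟩, h⟩
    simp only [grad_sum a b c _ p h] at h1 h2
    exact ⟨h, (mul_eq_zero.1 h1).resolve_left (hF.2 h), (mul_eq_zero.1 h2).resolve_left (hF.2 h)⟩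

lemma crit_sum {p : ℝ × ℝ} (hp : Crit a b c p) (x : ℝ × ℝ) :
    ∑ i, L a b c i x / L a b c i p = d := by
  obtain ⟨h, h1, h2⟩ := hp
  have : ∀ i, L a b c i x / L a b c i p = 1 + (x.1 - p.1) * (a i / L a b c i p)
      + (x.2 - p.2) * (b i / L a b c i p) := by
    intro i
    have := h i
    field_simp
    simp only [L]; ring
  simp only [this, Finset.sum_add_distrib, ← Finset.mul_sum, h1, h2]
  simp

lemma eq_of_two {i j : Fin d} (hD : D a b i j ≠ 0) {p q : ℝ × ℝ}
    (hi : L a b c i p = L a b c i q) (hj : L a b c j p = L a b c j q) : p = q := by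
  unfold D at hD
  simp only [L] at hi hj
  ext
  · apply mul_left_cancel₀ hD; linear_combination b j * hi - b i * hj
  · apply mul_left_cancel₀ hD; linear_combination a i * hj - a j * hi

lemma crit_unique {i j : Fin d} (hD : D a b i j ≠ 0) {p q : ℝ × ℝ} (hp : Crit a b c p)
    (hq : Crit a b c q) (h : ∀ k, 0 < L a b c k p * L a b c k q) : p = q := by
  have h1 := crit_sum hp q
  have h2 := crit_sum hq p
  have e : ∀ k, L a b c k q / L a b c k p + L a b c k p / L a b c k q - 2 =
      (L a b c k p - L a b c k q) ^ 2 / (L a b c k p * L a b c k q) := by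
    intro k
    have := hp.1 k
    have := hq.1 k
    field_simp
    ring
  have h3 : ∑ k, (L a b c k p - L a b c k q) ^ 2 / (L a b c k p * L a b c k q) = 0 := by
    simp only [← e, Finset.sum_sub_distrib, Finset.sum_add_distrib, h1, h2]
    simp; ring
  rw [Finset.sum_eq_zero_iff_of_nonneg
    (fun k _ => div_nonneg (sq_nonneg _) (h k).le)] at h3
  have h4 : ∀ k, L a b c k p = L a b c k q := by
    intro k
    have := h3 k (Finset.mem_univ _)
    rw [div_eq_zero_iff] at this
    have := this.resolve_right (h k).ne'
    exact sub_eq_zero.1 (pow_eq_zero_iff (two_ne_zero) |>.1 this)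
  exact eq_of_two hD (h4 i) (h4 j)

lemma contL (i : Fin d) : Continuous (L a b c i) := by
  unfold L; fun_prop

lemma compact_of {i j : Fin d} (hD : D a b i j ≠ 0) {K : Set (ℝ × ℝ)} (hK : IsClosed K)
    {s t M : ℝ} (hs : s ≠ 0) (ht : t ≠ 0)
    (h1 : ∀ x ∈ K, 0 ≤ s * L a b c i x ∧ s * L a b c i x ≤ M)
    (h2 : ∀ x ∈ K, 0 ≤ t * L a b c j x ∧ t * L a b c j x ≤ M) : IsCompact K := by
  have hc : IsCompact ((fun z : ℝ × ℝ =>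
    ((b j * (z.1 / s - c i) - b i * (z.2 / t - c j)) / D a b i j,
     (a i * (z.2 / t - c j) - a j * (z.1 / s - c i)) / D a b i j)) ''
      (Set.Icc 0 M ×ˢ Set.Icc 0 M)) := by
    apply (isCompact_Icc.prod isCompact_Icc).image
    fun_prop
  refine hc.of_isClosed_subset hK fun x hx => ?_
  refine ⟨(s * L a b c i x, t * L a b c j x), ⟨h1 x hx, h2 x hx⟩, ?_⟩
  ext
  · simp only [mul_div_cancel_left₀ _ hs, mul_div_cancel_left₀ _ ht]
    rw [div_eq_iff hD]; simp only [L, D]; ring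
  · simp only [mul_div_cancel_left₀ _ hs, mul_div_cancel_left₀ _ ht]
    rw [div_eq_iff hD]; simp only [L, D]; ring

lemma three {i j : Fin d} (o : Fin d) {q : ℝ × ℝ} (hi : L a b c i q = 0) (hj : L a b c j q = 0)
    (x : ℝ × ℝ) : D a b i j * (L a b c o x - L a b c o q) =
      D a b o j * L a b c i x + D a b i o * L a b c j x := by
  simp only [L, D] at *
  linear_combination (-a o * b j + a j * b o) * hi + (-a i * b o + a o * b i) * hj

/-- the cell of `p` has its vertex `q` on the lines `i`, `j` farthest from line `o` -/
structure Rel (a b c : Fin d → ℝ) (o i j : Fin d) (p q : ℝ × ℝ) : Prop where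
  hi : L a b c i q = 0
  hj : L a b c j q = 0
  hk : ∀ k, k ≠ i → k ≠ j → 0 < L a b c k p * L a b c k q
  si : L a b c o p * L a b c i p * D a b i j * D a b o j < 0
  sj : L a b c o p * L a b c j p * D a b j i * D a b o i < 0

lemma D_symm (i j : Fin d) : D a b i j = - D a b j i := by unfold D; ring

lemma Rel.symm {o i j : Fin d} {p q : ℝ × ℝ} (h : Rel a b c o i j p q) :
    Rel a b c o j i p q := ⟨h.hj, h.hi, fun k h1 h2 => h.hk k h2 h1, h.sj, h.si⟩

/-- `q` maximises -/
lemma Rel.max {o i j : Fin d} {p q : ℝ × ℝ} (h : Rel a b c o i j p q) (hD : D a b i j ≠ 0)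
    (x : ℝ × ℝ)
    (hxi : 0 ≤ L a b c i p * L a b c i x) (hxj : 0 ≤ L a b c j p * L a b c j x)
    (hm : L a b c o p * L a b c o q ≤ L a b c o p * L a b c o x) : x = q := by
  have h3 := three o h.hi h.hj x
  have hpi : L a b c i p ≠ 0 := by
    intro h0; have := h.si; simp [h0] at this
  have hpj : L a b c j p ≠ 0 := by
    intro h0; have := h.sj; simp [h0] at this
  have e : D a b i j ^ 2 * (L a b c o p * L a b c o x - L a b c o p * L a b c o q) =
    (L a b c o p * L a b c i p * D a b i j * D a b o j) *
      ((L a b c i p * L a b c i x) / L a b c i p ^ 2) +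
    (L a b c o p * L a b c j p * D a b j i * D a b o i) *
      ((L a b c j p * L a b c j x) / L a b c j p ^ 2) := by
    rw [D_symm j i, D_symm o i]
    field_simp
    linear_combination L a b c o p * h3
  have hl : 0 ≤ D a b i j ^ 2 * (L a b c o p * L a b c o x - L a b c o p * L a b c o q) :=
    mul_nonneg (sq_nonneg _) (sub_nonneg.2 hm)
  rw [e] at hl
  have n1 : 0 ≤ (L a b c i p * L a b c i x) / L a b c i p ^ 2 := div_nonneg hxi (sq_nonneg _)
  have n2 : 0 ≤ (L a b c j p * L a b c j x) / L a b c j p ^ 2 := div_nonneg hxj (sq_nonneg _)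
  have m1 := mul_nonpos_of_nonpos_of_nonneg h.si.le n1
  have m2 := mul_nonpos_of_nonpos_of_nonneg h.sj.le n2
  have z1 : (L a b c o p * L a b c i p * D a b i j * D a b o j) *
      ((L a b c i p * L a b c i x) / L a b c i p ^ 2) = 0 := by linarith
  have z2 : (L a b c o p * L a b c j p * D a b j i * D a b o i) *
      ((L a b c j p * L a b c j x) / L a b c j p ^ 2) = 0 := by linarith
  have w1 := (mul_eq_zero.1 z1).resolve_left h.si.ne
  have w2 := (mul_eq_zero.1 z2).resolve_left h.sj.ne
  have v1 : L a b c i x = 0 := by simpa [hpi] using w1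
  have v2 : L a b c j x = 0 := by simpa [hpj] using w2
  exact eq_of_two hD (v1.trans h.hi.symm) (v2.trans h.hj.symm)

lemma Rel.closed {o i j : Fin d} {p q : ℝ × ℝ} (h : Rel a b c o i j p q) (k : Fin d) :
    0 ≤ L a b c k p * L a b c k q := by
  by_cases h1 : k = i
  · simp [h1, h.hi]
  by_cases h2 : k = j
  · simp [h2, h.hj]
  exact (h.hk k h1 h2).le

/-- a point determines its pair -/
lemma Rel.pair_unique {o i j i' j' : Fin d} {p q q' : ℝ × ℝ} (h : Rel a b c o i j p q)
    (h' : Rel a b c o i' j' p q') (hD : D a b i j ≠ 0) (hD' : D a b i' j' ≠ 0) :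
    ({i, j} : Finset (Fin d)) = {i', j'} := by
  have hqq : q = q' := by
    rcases le_total (L a b c o p * L a b c o q) (L a b c o p * L a b c o q') with hle | hle
    · exact (h.max hD q' (h'.closed i) (h'.closed j) hle).symm
    · exact h'.max hD' q (h.closed i') (h.closed j') hle
  subst hqq
  have key : ∀ {i j}, Rel a b c o i j p q → ∀ k, k ∈ ({i, j} : Finset (Fin d)) ↔
      L a b c k q = 0 := by
    intro i j h k
    simp only [Finset.mem_insert, Finset.mem_singleton]
    constructor
    · rintro (rfl | rfl)
      · exact h.hi
      · exact h.hj
    · intro h0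
      by_contra hn
      push Not at hn
      have := h.hk k hn.1 hn.2
      simp [h0] at this
  ext k
  exact (key h k).trans (key h' k).symm

/-- a pair determines its point -/
lemma Rel.point_unique {o i j : Fin d} {p q p' q' : ℝ × ℝ} (h : Rel a b c o i j p q)
    (h' : Rel a b c o i j p' q') (hD : D a b i j ≠ 0) (hoi : o ≠ i) (hoj : o ≠ j)
    (hp : Crit a b c p) (hp' : Crit a b c p') : p = p' := by
  have hqq : q = q' := eq_of_two hD (h.hi.trans h'.hi.symm) (h.hj.trans h'.hj.symm)
  subst hqq
  have hg : ∀ k, k ≠ i → k ≠ j → 0 < L a b c k p * L a b c k p' := by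
    intro k h1 h2
    have := mul_pos (h.hk k h1 h2) (h'.hk k h1 h2)
    have e : L a b c k p * L a b c k q * (L a b c k p' * L a b c k q) =
      (L a b c k p * L a b c k p') * L a b c k q ^ 2 := by ring
    rw [e] at this
    exact pos_of_mul_pos_left this (sq_nonneg _)
  have ho := hg o hoi hoj
  refine crit_unique hD hp hp' fun k => ?_
  by_cases h1 : k = i
  · subst h1
    have := mul_pos_of_neg_of_neg h.si h'.si
    have e : L a b c o p * L a b c k p * D a b k j * D a b o j *
        (L a b c o p' * L a b c k p' * D a b k j * D a b o j) =
        (L a b c k p * L a b c k p') * ((L a b c o p * L a b c o p') *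
          (D a b k j * D a b o j) ^ 2) := by ring
    rw [e] at this
    exact pos_of_mul_pos_left this (mul_nonneg ho.le (sq_nonneg _))
  by_cases h2 : k = j
  · subst h2
    have := mul_pos_of_neg_of_neg h.sj h'.sj
    have e : L a b c o p * L a b c k p * D a b k i * D a b o i *
        (L a b c o p' * L a b c k p' * D a b k i * D a b o i) =
        (L a b c k p * L a b c k p') * ((L a b c o p * L a b c o p') *
          (D a b k i * D a b o i) ^ 2) := by ring
    rw [e] at this
    exact pos_of_mul_pos_left this (mul_nonneg ho.le (sq_nonneg _))
  exact hg k h1 h2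

lemma small (u w : Fin d → ℝ) (h : ∀ k, 0 < u k ∨ (0 ≤ u k ∧ 0 ≤ w k)) :
    ∃ ε > 0, ∀ k, 0 ≤ u k + ε * w k := by
  have : ∀ᶠ ε in nhdsWithin (0 : ℝ) (Set.Ioi 0), ∀ k, 0 ≤ u k + ε * w k := by
    rw [Filter.eventually_all]
    intro k
    rcases h k with hk | ⟨h1, h2⟩
    · have hc : Filter.Tendsto (fun ε : ℝ => u k + ε * w k) (nhds 0) (nhds (u k + 0 * w k)) :=
        (by fun_prop : Continuous (fun ε : ℝ => u k + ε * w k)).tendsto 0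
      have : ∀ᶠ ε in nhds (0:ℝ), 0 < u k + ε * w k := hc.eventually_const_lt (by simpa using hk)
      exact (this.filter_mono nhdsWithin_le_nhds).mono fun _ h => h.le
    · filter_upwards [self_mem_nhdsWithin] with ε hε
      exact add_nonneg h1 (mul_nonneg (le_of_lt hε) h2)
  obtain ⟨ε, h1, h2⟩ := (this.and self_mem_nhdsWithin).exists
  exact ⟨ε, h2, h1⟩

/-- same with strict inequalities -/
lemma small' (u w : Fin d → ℝ) (h : ∀ k, 0 < u k ∨ (0 ≤ u k ∧ 0 < w k)) :
    ∃ ε > 0, ∀ k, 0 < u k + ε * w k := by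
  have : ∀ᶠ ε in nhdsWithin (0 : ℝ) (Set.Ioi 0), ∀ k, 0 < u k + ε * w k := by
    rw [Filter.eventually_all]
    intro k
    rcases h k with hk | ⟨h1, h2⟩
    · have hc : Filter.Tendsto (fun ε : ℝ => u k + ε * w k) (nhds 0) (nhds (u k + 0 * w k)) :=
        (by fun_prop : Continuous (fun ε : ℝ => u k + ε * w k)).tendsto 0
      have : ∀ᶠ ε in nhds (0:ℝ), 0 < u k + ε * w k := hc.eventually_const_lt (by simpa using hk)
      exact this.filter_mono nhdsWithin_le_nhds
    · filter_upwards [self_mem_nhdsWithin] with ε hε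
      exact add_pos_of_nonneg_of_pos h1 (mul_pos hε h2)
  obtain ⟨ε, h1, h2⟩ := (this.and self_mem_nhdsWithin).exists
  exact ⟨ε, h2, h1⟩

/-- every critical point has a pair -/
lemma exists_pair (hs : ∀ i j, i ≠ j → D a b i j ≠ 0) (hne : ∀ i : Fin d, ∃ j, i ≠ j)
    (hc : ∀ i j k, i ≠ j → i ≠ k → j ≠ k → ∀ p, L a b c i p = 0 → L a b c j p = 0 →
      L a b c k p ≠ 0) (o : Fin d) (p : ℝ × ℝ) (hp : Crit a b c p) :
    ∃ i j q, i ≠ j ∧ o ≠ i ∧ o ≠ j ∧ Rel a b c o i j p q := by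
  let C : Set (ℝ × ℝ) := {x | ∀ k, 0 ≤ L a b c k p * L a b c k x}
  have hCc : IsClosed C := by
    have : C = ⋂ k, {x | 0 ≤ L a b c k p * L a b c k x} := by ext; simp [C]
    rw [this]
    exact isClosed_iInter fun k => isClosed_le continuous_const (continuous_const.mul (contL k))
  have hbd : ∀ x ∈ C, ∀ k, L a b c k p * L a b c k x ≤ d * L a b c k p ^ 2 := by
    intro x hx k
    have h1 := crit_sum hp x
    have h2 : ∀ k, 0 ≤ L a b c k x / L a b c k p := fun k => by
      have h0 := hp.1 k
      have : L a b c k x / L a b c k p = L a b c k p * L a b c k x / L a b c k p ^ 2 := by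
        field_simp
      rw [this]; exact div_nonneg (hx k) (sq_nonneg _)
    have h3 := Finset.single_le_sum (fun k _ => h2 k) (Finset.mem_univ k)
    rw [h1] at h3
    have h0 := hp.1 k
    have : L a b c k p * L a b c k x = L a b c k x / L a b c k p * L a b c k p ^ 2 := by
      field_simp
    rw [this]
    exact mul_le_mul_of_nonneg_right h3 (sq_nonneg _)
  obtain ⟨o', ho'⟩ := hne o
  have hcomp : IsCompact C := compact_of (hs o o' ho') hCc
    (M := max (d * L a b c o p ^ 2) (d * L a b c o' p ^ 2)) (hp.1 o) (hp.1 o')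
    (fun x hx => ⟨hx o, (hbd x hx o).trans (le_max_left _ _)⟩)
    (fun x hx => ⟨hx o', (hbd x hx o').trans (le_max_right _ _)⟩)
  have hpC : p ∈ C := fun k => mul_self_nonneg _
  obtain ⟨x, hxC, hmax⟩ := hcomp.exists_isMaxOn ⟨p, hpC⟩
    (f := fun x => L a b c o p * L a b c o x)
    (continuous_const.mul (contL o)).continuousOn
  have move : ∀ v : ℝ × ℝ, (∀ k, L a b c k x = 0 → 0 ≤ L a b c k p * (a k * v.1 + b k * v.2)) →
      L a b c o p * (a o * v.1 + b o * v.2) ≤ 0 := by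
    intro v hv
    by_contra hcon
    push Not at hcon
    obtain ⟨ε, hε, h⟩ := small (fun k => L a b c k p * L a b c k x)
      (fun k => L a b c k p * (a k * v.1 + b k * v.2)) (by
        intro k
        by_cases h0 : L a b c k x = 0
        · exact Or.inr ⟨hxC k, hv k h0⟩
        · exact Or.inl (lt_of_le_of_ne (hxC k) (mul_ne_zero (hp.1 k) h0).symm))
    have e : ∀ k, L a b c k (x + ε • v) = L a b c k x + ε * (a k * v.1 + b k * v.2) := by
      intro k; simp only [L, Prod.fst_add, Prod.snd_add, Prod.smul_fst, Prod.smul_snd,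
        smul_eq_mul]; ring
    have hm := hmax (show x + ε • v ∈ C from fun k => by
      rw [e]; have := h k; nlinarith)
    simp only [Set.mem_ofPred_eq, e] at hm
    have := mul_pos hε hcon
    nlinarith
  have hxo : L a b c o x ≠ 0 := by
    intro h0
    have := hmax hpC
    simp only [Set.mem_ofPred_eq, h0, mul_zero] at this
    have h1 : 0 < L a b c o p * L a b c o p := mul_self_pos.2 (hp.1 o)
    linarith
  have c1 : ∃ i, L a b c i x = 0 := by
    by_contra hcon
    push Not at hcon
    have := move (L a b c o p * a o, L a b c o p * b o) (fun k hk => absurd hk (hcon k))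
    have h1 := mul_pos (sq_pos_of_ne_zero (hp.1 o)) (ab_ne hs o o' ho')
    simp only at this
    nlinarith
  obtain ⟨i, hi⟩ := c1
  have hoi : o ≠ i := fun h => hxo (h ▸ hi)
  have c2 : ∃ j, i ≠ j ∧ L a b c j x = 0 := by
    by_contra hcon
    push Not at hcon
    have := move (L a b c o p * D a b o i * b i, - (L a b c o p * D a b o i * a i)) (fun k hk => by
      by_cases hki : i = k
      · subst hki; apply le_of_eq; ring
      · exact absurd hk (hcon k hki))
    have h1 := sq_pos_of_ne_zero (mul_ne_zero (hp.1 o) (hs o i hoi))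
    have e : L a b c o p * (a o * (L a b c o p * D a b o i * b i) +
      b o * -(L a b c o p * D a b o i * a i)) = (L a b c o p * D a b o i) ^ 2 := by
      unfold D; ring
    simp only at this
    linarith
  obtain ⟨j, hij, hj⟩ := c2
  have hoj : o ≠ j := fun h => hxo (h ▸ hj)
  have only : ∀ k, L a b c k x = 0 → k = i ∨ k = j := by
    intro k hk
    by_contra hn
    push Not at hn
    exact hc i j k hij hn.1.symm hn.2.symm x hi hj hk
  have sg : ∀ i j, i ≠ j → o ≠ i → o ≠ j → (∀ k, L a b c k x = 0 → k = i ∨ k = j) →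
      L a b c o p * L a b c i p * D a b i j * D a b o j < 0 := by
    intro i j hij hoi hoj only
    have := move (L a b c i p * D a b i j * b j, - (L a b c i p * D a b i j * a j)) (fun k hk => by
      rcases only k hk with rfl | rfl
      · have e : L a b c k p * (a k * (L a b c k p * D a b k j * b j) +
          b k * -(L a b c k p * D a b k j * a j)) = (L a b c k p * D a b k j) ^ 2 := by
          unfold D; ring
        simp only [e]; positivity
      · apply le_of_eq; ring)
    have e : L a b c o p * (a o * (L a b c i p * D a b i j * b j) +
      b o * -(L a b c i p * D a b i j * a j)) =
        L a b c o p * L a b c i p * D a b i j * D a b o j := by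
      simp only [D]; ring
    simp only [e] at this
    exact lt_of_le_of_ne this (mul_ne_zero (mul_ne_zero (mul_ne_zero (hp.1 o) (hp.1 i))
      (hs i j hij)) (hs o j hoj))
  refine ⟨i, j, x, hij, hoi, hoj, hi, hj, ?_, sg i j hij hoi hoj only,
    sg j i hij.symm hoj hoi fun k hk => (only k hk).symm⟩
  intro k h1 h2
  refine lt_of_le_of_ne (hxC k) (mul_ne_zero (hp.1 k) fun h0 => ?_).symm
  exact (only k h0).elim h1 h2

/-- every pair has a critical point -/
lemma exists_point (hs : ∀ i j, i ≠ j → D a b i j ≠ 0)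
    (hc : ∀ i j k, i ≠ j → i ≠ k → j ≠ k → ∀ p, L a b c i p = 0 → L a b c j p = 0 →
      L a b c k p ≠ 0) (o i j : Fin d) (hij : i ≠ j) (hoi : o ≠ i) (hoj : o ≠ j) :
    ∃ p q, Crit a b c p ∧ Rel a b c o i j p q := by
  have hD := hs i j hij
  obtain ⟨q, hi, hj⟩ : ∃ q, L a b c i q = 0 ∧ L a b c j q = 0 := by
    refine ⟨((b i * c j - b j * c i) / D a b i j, (a j * c i - a i * c j) / D a b i j), ?_, ?_⟩
    · simp only [L]; field_simp; unfold D; ring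
    · simp only [L]; field_simp; unfold D; ring
  have hqk : ∀ k, k ≠ i → k ≠ j → L a b c k q ≠ 0 := fun k h1 h2 =>
    hc i j k hij h1.symm h2.symm q hi hj
  have hqo := hqk o hoi hoj
  obtain ⟨s, hsi, hsj, hsk⟩ : ∃ s : Fin d → ℝ, s i = -(L a b c o q * D a b i j * D a b o j) ∧
      s j = -(L a b c o q * D a b j i * D a b o i) ∧ ∀ k, k ≠ i → k ≠ j → s k = L a b c k q := by
    refine ⟨fun k => if k = i then -(L a b c o q * D a b i j * D a b o j) else
      if k = j then -(L a b c o q * D a b j i * D a b o i) else L a b c k q, by simp,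
      by simp [hij.symm], fun k h1 h2 => by simp [h1, h2]⟩
  have hsi0 : s i ≠ 0 := by
    rw [hsi]; exact neg_ne_zero.2 (mul_ne_zero (mul_ne_zero hqo hD) (hs o j hoj))
  have hsj0 : s j ≠ 0 := by
    rw [hsj]; exact neg_ne_zero.2 (mul_ne_zero (mul_ne_zero hqo (hs j i hij.symm)) (hs o i hoi))
  let K : Set (ℝ × ℝ) := {x | ∀ k, 0 ≤ s k * L a b c k x}
  have hKc : IsClosed K := by
    have : K = ⋂ k, {x | 0 ≤ s k * L a b c k x} := by ext; simp [K]
    rw [this]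
    exact isClosed_iInter fun k => isClosed_le continuous_const (continuous_const.mul (contL k))
  have hbd : ∀ x ∈ K, s i * L a b c i x + s j * L a b c j x ≤ D a b i j ^ 2 * L a b c o q ^ 2 := by
    intro x hx
    have h1 := three o hi hj x
    have h2 := hx o
    rw [hsk o hoi hoj] at h2
    have h3 := mul_nonneg (sq_nonneg (D a b i j)) h2
    rw [hsi, hsj, D_symm j i, D_symm o i]
    have e : D a b i j ^ 2 * (L a b c o q * L a b c o x) = D a b i j ^ 2 * L a b c o q ^ 2 +
      D a b i j * L a b c o q * (D a b o j * L a b c i x + D a b i o * L a b c j x) := by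
      linear_combination D a b i j * L a b c o q * h1
    nlinarith
  have hcomp : IsCompact K := compact_of hD hKc (M := D a b i j ^ 2 * L a b c o q ^ 2) hsi0 hsj0
    (fun x hx => ⟨hx i, by linarith [hbd x hx, hx j]⟩)
    (fun x hx => ⟨hx j, by linarith [hbd x hx, hx i]⟩)
  -- an interior point
  obtain ⟨x0, hx0⟩ : ∃ x0, ∀ k, 0 < s k * L a b c k x0 := by
    obtain ⟨w, hwi, hwj⟩ : ∃ w : ℝ × ℝ, a i * w.1 + b i * w.2 = s i ∧
        a j * w.1 + b j * w.2 = s j := by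
      refine ⟨((b j * s i - b i * s j) / D a b i j, (a i * s j - a j * s i) / D a b i j), ?_, ?_⟩
      · field_simp; simp only [D]; ring
      · field_simp; simp only [D]; ring
    obtain ⟨ε, hε, h⟩ := small' (fun k => s k * L a b c k q)
      (fun k => s k * (a k * w.1 + b k * w.2)) (by
        intro k
        by_cases h1 : k = i
        · subst h1; right; simp only [hi, hwi]; exact ⟨by simp, mul_self_pos.2 hsi0⟩
        by_cases h2 : k = j
        · subst h2; right; simp only [hj, hwj]; exact ⟨by simp, mul_self_pos.2 hsj0⟩
        · left; simp only [hsk k h1 h2]; exact mul_self_pos.2 (hqk k h1 h2))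
    refine ⟨q + ε • w, fun k => ?_⟩
    have e : L a b c k (q + ε • w) = L a b c k q + ε * (a k * w.1 + b k * w.2) := by
      simp only [L, Prod.fst_add, Prod.snd_add, Prod.smul_fst, Prod.smul_snd,
        smul_eq_mul]; ring
    rw [e]
    have := h k
    nlinarith
  obtain ⟨p, hpK, hmax⟩ := hcomp.exists_isMaxOn ⟨x0, fun k => (hx0 k).le⟩
    (f := fun x => ∏ k, s k * L a b c k x)
    (continuous_finsetProd _ fun k _ => continuous_const.mul (contL k)).continuousOn
  have hpp : 0 < ∏ k, s k * L a b c k p :=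
    lt_of_lt_of_le (Finset.prod_pos fun k _ => hx0 k) (hmax fun k => (hx0 k).le)
  have hpk : ∀ k, 0 < s k * L a b c k p := fun k =>
    lt_of_le_of_ne (hpK k) (Finset.prod_ne_zero_iff.1 hpp.ne' k (Finset.mem_univ _)).symm
  have hev : ∀ᶠ y in nhds p, (∏ k, s k) * F a b c y ≤ (∏ k, s k) * F a b c p := by
    have h1 : ∀ᶠ y in nhds p, ∀ k, 0 < s k * L a b c k y := by
      rw [Filter.eventually_all]
      intro k
      exact ((continuous_const.mul (contL k)).tendsto p).eventually_const_lt (hpk k)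
    filter_upwards [h1] with y hy
    have := hmax (show y ∈ K from fun k => (hy k).le)
    simpa only [Set.mem_ofPred_eq, Finset.prod_mul_distrib, F] using this
  have hs0 : ∏ k, s k ≠ 0 := by
    rw [Finset.prod_mul_distrib] at hpp
    exact left_ne_zero_of_mul hpp.ne'
  have hdx0 : pdx (F a b c) p = 0 := by
    have h1 : IsLocalMax (fun t => (∏ k, s k) * F a b c (t, p.2)) p.1 :=
      ((by fun_prop : Continuous fun t : ℝ => (t, p.2)).tendsto p.1).eventually hev
    have h2 := h1.deriv_eq_zero
    rw [deriv_const_mul_field] at h2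
    exact (mul_eq_zero.1 h2).resolve_left hs0
  have hdy0 : pdy (F a b c) p = 0 := by
    have h1 : IsLocalMax (fun t => (∏ k, s k) * F a b c (p.1, t)) p.2 :=
      ((by fun_prop : Continuous fun t : ℝ => (p.1, t)).tendsto p.2).eventually hev
    have h2 := h1.deriv_eq_zero
    rw [deriv_const_mul_field] at h2
    exact (mul_eq_zero.1 h2).resolve_left hs0
  have hF : F a b c p ≠ 0 :=
    Finset.prod_ne_zero_iff.2 fun k _ => right_ne_zero_of_mul (hpk k).ne'
  refine ⟨p, q, (crit_iff p).2 ⟨⟨hdx0, hdy0⟩, hF⟩, hi, hj, ?_, ?_, ?_⟩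
  · intro k h1 h2
    have := hpk k
    rwa [hsk k h1 h2, mul_comm] at this
  · have h1 := hpk i
    have h2 := hpk o
    rw [hsk o hoi hoj] at h2
    rw [hsi] at h1
    have h3 := mul_pos h1 h2
    have h4 : 0 < (-(L a b c o p * L a b c i p * D a b i j * D a b o j)) * L a b c o q ^ 2 := by
      nlinarith
    have := pos_of_mul_pos_left h4 (sq_nonneg _)
    linarith
  · have h1 := hpk j
    have h2 := hpk o
    rw [hsk o hoi hoj] at h2
    rw [hsj] at h1
    have h3 := mul_pos h1 h2
    have h4 : 0 < (-(L a b c o p * L a b c j p * D a b j i * D a b o i)) * L a b c o q ^ 2 := by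
      nlinarith
    have := pos_of_mul_pos_left h4 (sq_nonneg _)
    linarith

lemma count (hs : ∀ i j, i ≠ j → D a b i j ≠ 0) (hne : ∀ i : Fin d, ∃ j, i ≠ j)
    (hc : ∀ i j k, i ≠ j → i ≠ k → j ≠ k → ∀ p, L a b c i p = 0 → L a b c j p = 0 →
      L a b c k p ≠ 0) (o : Fin d) :
    {p | Crit a b c p}.Finite ∧ {p | Crit a b c p}.ncard = (d - 1).choose 2 := by
  classical
  let P : Finset (Finset (Fin d)) := (Finset.univ.erase o).powersetCard 2
  have hP : P.card = (d - 1).choose 2 := by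
    simp [P, Finset.card_powersetCard, Finset.card_erase_of_mem]
  have hmem : ∀ i j, i ≠ j → o ≠ i → o ≠ j → ({i, j} : Finset (Fin d)) ∈ P := by
    intro i j hij hoi hoj
    rw [Finset.mem_powersetCard]
    refine ⟨fun k hk => ?_, Finset.card_pair hij⟩
    simp only [Finset.mem_insert, Finset.mem_singleton] at hk
    rcases hk with rfl | rfl
    · simp [hoi.symm]
    · simp [hoj.symm]
  have hex : ∀ e : Finset (Fin d), ∃ p : ℝ × ℝ, e ∈ P → ∃ i j q, i ≠ j ∧ o ≠ i ∧ o ≠ j ∧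
      e = {i, j} ∧ Crit a b c p ∧ Rel a b c o i j p q := by
    intro e
    by_cases he : e ∈ P
    · rw [Finset.mem_powersetCard] at he
      obtain ⟨i, j, hij, rfl⟩ := Finset.card_eq_two.1 he.2
      have hoi : o ≠ i := by
        have := he.1 (show i ∈ ({i, j} : Finset (Fin d)) by simp)
        exact (Finset.ne_of_mem_erase this).symm
      have hoj : o ≠ j := by
        have := he.1 (show j ∈ ({i, j} : Finset (Fin d)) by simp)
        exact (Finset.ne_of_mem_erase this).symm
      obtain ⟨p, q, h1, h2⟩ := exists_point hs hc o i j hij hoi hoj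
      exact ⟨p, fun _ => ⟨i, j, q, hij, hoi, hoj, rfl, h1, h2⟩⟩
    · exact ⟨0, fun h => absurd h he⟩
  choose g hg using hex
  have hinj : Set.InjOn g P := by
    intro e he e' he' hee
    obtain ⟨i, j, q, hij, -, -, rfl, -, h⟩ := hg e he
    obtain ⟨i', j', q', hij', -, -, rfl, -, h'⟩ := hg e' he'
    rw [hee] at h
    exact h.pair_unique h' (hs i j hij) (hs i' j' hij')
  have himg : {p | Crit a b c p} = ↑(P.image g) := by
    ext p
    simp only [Set.mem_ofPred_eq, Finset.coe_image, Set.mem_image, Finset.mem_coe]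
    constructor
    · intro hp
      obtain ⟨i, j, q, hij, hoi, hoj, h⟩ := exists_pair hs hne hc o p hp
      have hm := hmem i j hij hoi hoj
      refine ⟨{i, j}, hm, ?_⟩
      obtain ⟨i', j', q', hij', hoi', hoj', he, hp', h'⟩ := hg _ hm
      have hi' : i' = i ∨ i' = j := by
        have : i' ∈ ({i, j} : Finset (Fin d)) := by rw [he]; simp
        simpa using this
      have hj' : j' = i ∨ j' = j := by
        have : j' ∈ ({i, j} : Finset (Fin d)) := by rw [he]; simp
        simpa using this
      have h'' : Rel a b c o i j (g {i, j}) q' := by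
        rcases hi' with e1 | e1 <;> rcases hj' with e2 | e2
        · exact absurd (e1.trans e2.symm) hij'
        · rwa [e1, e2] at h'
        · rw [e1, e2] at h'; exact h'.symm
        · exact absurd (e1.trans e2.symm) hij'
      exact h''.point_unique h (hs i j hij) hoi hoj hp' hp
    · rintro ⟨e, he, rfl⟩
      obtain ⟨i, j, q, -, -, -, -, h, -⟩ := hg e he
      exact h
  rw [himg]
  refine ⟨Finset.finite_toSet _, ?_⟩
  rw [Set.ncard_coe_finset, Finset.card_image_of_injOn hinj, hP]

end SA

/-- Lemma 1: for a real simple line arrangement of `d ≥ 3` lines (pairwise non-parallel,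
pairwise distinct, no three concurrent), all critical points of the product `f` of the `d`
affine-linear forms are non-degenerate, and `f` has exactly `(d-1).choose 2` critical points
`p` with `f p ≠ 0`. -/
theorem stmt0 (d : ℕ) (hd : 3 ≤ d)
    (a b c : Fin d → ℝ) (ℓ : Fin d → ℝ × ℝ → ℝ)
    (hℓ : ∀ i p, ℓ i p = a i * p.1 + b i * p.2 + c i)
    (hsimple : ∀ i j, i ≠ j → a i * b j - a j * b i ≠ 0)
    (hconc : ∀ i j k, i ≠ j → i ≠ k → j ≠ k →
      ¬ ∃ p : ℝ × ℝ, ℓ i p = 0 ∧ ℓ j p = 0 ∧ ℓ k p = 0)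
    (f : ℝ × ℝ → ℝ) (hf : ∀ p, f p = ∏ i, ℓ i p) :
    (∀ p : ℝ × ℝ, pdx f p = 0 ∧ pdy f p = 0 → hessDet2 f p ≠ 0) ∧
    {p : ℝ × ℝ | (pdx f p = 0 ∧ pdy f p = 0) ∧ f p ≠ 0}.Finite ∧
    {p : ℝ × ℝ | (pdx f p = 0 ∧ pdy f p = 0) ∧ f p ≠ 0}.ncard = (d - 1).choose 2 := by
  obtain rfl : ℓ = SA.L a b c := by funext i p; exact hℓ i p
  obtain rfl : f = SA.F a b c := by funext p; exact hf p
  have hne : ∀ i : Fin d, ∃ j, i ≠ j := by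
    have : Nontrivial (Fin d) := Fin.nontrivial_iff_two_le.2 (by omega)
    intro i
    obtain ⟨j, hj⟩ := exists_ne i
    exact ⟨j, hj.symm⟩
  have hs : ∀ i j, i ≠ j → SA.D a b i j ≠ 0 := hsimple
  have hc : ∀ i j k, i ≠ j → i ≠ k → j ≠ k → ∀ p, SA.L a b c i p = 0 → SA.L a b c j p = 0 →
      SA.L a b c k p ≠ 0 := fun i j k h1 h2 h3 p h4 h5 h6 => hconc i j k h1 h2 h3 ⟨p, h4, h5, h6⟩
  let o : Fin d := ⟨0, by omega⟩
  have hcount := SA.count hs hne hc o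
  have hset : {p : ℝ × ℝ | (pdx (SA.F a b c) p = 0 ∧ pdy (SA.F a b c) p = 0) ∧
      SA.F a b c p ≠ 0} = {p | SA.Crit a b c p} := by
    ext p
    exact (SA.crit_iff p).symm
  refine ⟨?_, ?_⟩
  · rintro p ⟨hx, hy⟩
    by_cases h : ∃ i, SA.L a b c i p = 0
    · obtain ⟨i, hi⟩ := h
      exact SA.nondeg_on hs hne hc p i hi hx hy
    · push Not at h
      have hcr := (SA.crit_iff p).2 ⟨⟨hx, hy⟩, Finset.prod_ne_zero_iff.2 fun i _ => h i⟩
      obtain ⟨j, hj⟩ := hne o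
      exact SA.nondeg_off hs o j hj p h hcr.2.1 hcr.2.2
  · rw [hset]
    exact hcount
end
end

section
/- Let J₆ : ℝ² → ℝ be the degree-6 real folding-type polynomial J₆(x,y) = −1 + 2·Re(j₆(x+iy, x−iy)) with j₆(u,v) = (2−8b)u³ − b·u⁶ + 6uv + 6b·u⁴v − (9/2)u²v², b = exp(−iπ/3). Then J₆ has exactly 25 critical points in ℝ²; at every critical point the value of J₆ is 0, −1, or 8; exactly 15 critical points have value 0, exactly 7 have value −1, and exactly 3 have value 8. -/
noncomputable section

/-- `bC = exp(-iπ/3)`. -/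
def bC : ℂ := Complex.exp (-((Real.pi : ℂ) / 3) * Complex.I)

/-- The polynomial `j6(u,v)`. -/
def j6 (u v : ℂ) : ℂ := (2 - 8*bC)*u^3 - bC*u^6 + 6*u*v + 6*bC*u^4*v - (9/2)*u^2*v^2

/-- The real folding-type polynomial `J6(x,y) = -1 + 2 Re(j6(x+iy, x-iy))`, as a
function on `ℝ × ℝ`. -/
def J6 : ℝ × ℝ → ℝ := fun p =>
  -1 + 2 * (j6 ((p.1 : ℂ) + (p.2 : ℂ) * Complex.I) ((p.1 : ℂ) - (p.2 : ℂ) * Complex.I)).re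

theorem elim (p q C : ℝ) (hC : C ≠ 0) (h1 : -p -6*q - (p^2-3*q^2)/2 - 3*p*q + 2*C + 5*C*(p+3*q)/2 - 3*C^2 = 0)
  (h2 : 2*p - q - p*q + (p^2-3*q^2)/2 + 3*C*(q-p)/2=0) (h3 : p^2+3*q^2=C^3) :
  q*((2*q-1)*(2*q+1)*(12*q^2+12*q-1))=0 := by
  grind
theorem qa (p C : ℝ) (hC : C ≠ 0) (q : ℝ) (hq : 2*q-1=0) (h1 : -p -6*q - (p^2-3*q^2)/2 - 3*p*q + 2*C + 5*C*(p+3*q)/2 - 3*C^2 = 0)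
  (h2 : 2*p - q - p*q + (p^2-3*q^2)/2 + 3*C*(q-p)/2=0) (h3 : p^2+3*q^2=C^3) :
  (2*p-1)*((2*p+1)*((2*p-17)^2-108)) = 0 := by
  grind
theorem qb (p C : ℝ) (hC : C ≠ 0) (q : ℝ) (hq : 2*q+1=0) (h1 : -p -6*q - (p^2-3*q^2)/2 - 3*p*q + 2*C + 5*C*(p+3*q)/2 - 3*C^2 = 0)
  (h2 : 2*p - q - p*q + (p^2-3*q^2)/2 + 3*C*(q-p)/2=0) (h3 : p^2+3*q^2=C^3) :
  2*p-1 = 0 := by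
  grind
theorem qc (p C : ℝ) (hC : C ≠ 0) (q : ℝ) (hq : 12*q^2+12*q-1=0) (h1 : -p -6*q - (p^2-3*q^2)/2 - 3*p*q + 2*C + 5*C*(p+3*q)/2 - 3*C^2 = 0)
  (h2 : 2*p - q - p*q + (p^2-3*q^2)/2 + 3*C*(q-p)/2=0) (h3 : p^2+3*q^2=C^3) :
  p = 1/2 - 6*q := by
  grind
theorem qd (p C : ℝ) (hC : C ≠ 0) (q : ℝ) (hq : q=0) (h1 : -p -6*q - (p^2-3*q^2)/2 - 3*p*q + 2*C + 5*C*(p+3*q)/2 - 3*C^2 = 0)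
  (h2 : 2*p - q - p*q + (p^2-3*q^2)/2 + 3*C*(q-p)/2=0) (h3 : p^2+3*q^2=C^3) :
  p = 8 := by
  grind

/-- `√3`. -/
def s3 : ℝ := Real.sqrt 3

lemma s3_sq : s3 ^ 2 = 3 := Real.sq_sqrt (by norm_num)

lemma s3_pos : 0 < s3 := Real.sqrt_pos.2 (by norm_num)

lemma s3_lo : 1.73 < s3 := by nlinarith [s3_sq, s3_pos]

lemma s3_hi : s3 < 1.74 := by nlinarith [s3_sq, s3_pos]

lemma bC_eq : bC = ⟨1/2, -(s3/2)⟩ := by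
  have h : (-((Real.pi : ℂ) / 3) * Complex.I) = ((-(Real.pi/3) : ℝ) : ℂ) * Complex.I := by
    push_cast; ring
  unfold bC
  rw [h]
  apply Complex.ext
  · rw [Complex.exp_ofReal_mul_I_re, Real.cos_neg, Real.cos_pi_div_three]
  · rw [Complex.exp_ofReal_mul_I_im, Real.sin_neg, Real.sin_pi_div_three]; rfl

/-- real part of `u^3` -/
def PP (x y : ℝ) : ℝ := x^3 - 3*x*y^2
/-- imaginary part of `u^3` -/
def RR (x y : ℝ) : ℝ := 3*x^2*y - y^3
/-- squared modulus -/
def CC (x y : ℝ) : ℝ := x^2 + y^2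

lemma norm_rel (x y : ℝ) : PP x y ^ 2 + RR x y ^ 2 = CC x y ^ 3 := by
  unfold PP RR CC; ring

/-- `J6` through the invariants. -/
def GG (P R C : ℝ) : ℝ :=
  -1 + 2*(-2*P - 4*s3*R - ((P^2-R^2)/2 + s3*P*R) + 3*C*(P+s3*R)) + 12*C - 9*C^2

lemma J6_eq (x y : ℝ) : J6 (x, y) = GG (PP x y) (RR x y) (CC x y) := by
  have hu : ((x : ℂ) + (y : ℂ) * Complex.I) = ⟨x, y⟩ := by
    apply Complex.ext <;> simp
  have hv : ((x : ℂ) - (y : ℂ) * Complex.I) = ⟨x, -y⟩ := by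
    apply Complex.ext <;> simp
  have e : ∀ b u v : ℂ, (2 - 8*b)*u^3 - b*u^6 + 6*u*v + 6*b*u^4*v - (9/2)*u^2*v^2
      = (2 - 8*b)*u^3 - b*(u^3*u^3) + 6*(u*v) + 6*(b*(u^3*(u*v))) - (9/2)*((u*v)*(u*v)) := by
    intros; ring
  have hA : (⟨x, y⟩ : ℂ)^3 = ⟨PP x y, RR x y⟩ := by
    apply Complex.ext <;> simp [pow_succ, PP, RR] <;> ring
  have hC : (⟨x, y⟩ : ℂ) * ⟨x, -y⟩ = ⟨CC x y, 0⟩ := by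
    apply Complex.ext <;> simp [CC] <;> ring
  have h9 : (9/2 : ℂ) = ⟨9/2, 0⟩ := by
    apply Complex.ext <;> norm_num
  unfold J6 j6
  simp only [hu, hv]
  rw [e, hA, hC, bC_eq, h9]
  unfold GG
  generalize PP x y = P
  generalize RR x y = R
  generalize CC x y = C
  simp
  ring

/-- derivative of `GG` along a direction -/
def DG (P R C p r c : ℝ) : ℝ :=
  2*(-2 - P - s3*R + 3*C)*p + 2*(-4*s3 + R - s3*P + 3*s3*C)*r + (6*(P+s3*R)+12-18*C)*c

lemma GG_deriv {P R C : ℝ → ℝ} {p r c t : ℝ} (hP : HasDerivAt P p t) (hR : HasDerivAt R r t)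
    (hC : HasDerivAt C c t) :
    HasDerivAt (fun t => GG (P t) (R t) (C t)) (DG (P t) (R t) (C t) p r c) t := by
  unfold GG
  have := ((((((hP.const_mul (-2)).sub (hR.const_mul (4*s3))).sub
    ((((hP.pow 2).sub (hR.pow 2)).div_const 2).add ((hP.const_mul s3).mul hR))).add
    ((hC.const_mul 3).mul (hP.add (hR.const_mul s3)))).const_mul 2).const_add (-1)).add
    (hC.const_mul 12) |>.sub ((hC.pow 2).const_mul 9)
  refine HasDerivAt.congr_deriv this ?_
  simp [DG]
  ring

lemma pdx_eq (x y : ℝ) : pdx J6 (x, y) =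
    DG (PP x y) (RR x y) (CC x y) (3*x^2-3*y^2) (6*x*y) (2*x) := by
  unfold pdx
  simp only [J6_eq]
  apply HasDerivAt.deriv
  apply GG_deriv (P := fun t => PP t y) (R := fun t => RR t y) (C := fun t => CC t y)
  · have := ((hasDerivAt_id x).pow 3).sub (((hasDerivAt_id x).const_mul 3).mul_const (y^2))
    refine HasDerivAt.congr_deriv this ?_
    simp
  · have := ((((hasDerivAt_id x).pow 2).const_mul 3).mul_const y).sub_const (y^3)
    refine HasDerivAt.congr_deriv this ?_
    simp; left; ring
  · have := ((hasDerivAt_id x).pow 2).add_const (y^2)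
    refine HasDerivAt.congr_deriv this ?_
    simp

lemma pdy_eq (x y : ℝ) : pdy J6 (x, y) =
    DG (PP x y) (RR x y) (CC x y) (-6*x*y) (3*x^2-3*y^2) (2*y) := by
  unfold pdy
  simp only [J6_eq]
  apply HasDerivAt.deriv
  apply GG_deriv (P := fun t => PP x t) (R := fun t => RR x t) (C := fun t => CC x t)
  · have := (((hasDerivAt_id y).pow 2).const_mul (3*x)).const_sub (x^3)
    refine HasDerivAt.congr_deriv this ?_
    simp; ring
  · have := ((hasDerivAt_id y).const_mul (3*x^2)).sub ((hasDerivAt_id y).pow 3)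
    refine HasDerivAt.congr_deriv this ?_
    simp
  · have := ((hasDerivAt_id y).pow 2).const_add (x^2)
    refine HasDerivAt.congr_deriv this ?_
    simp

/-- real part of `u ∂_u J6 / 6` -/
def E1 (P R C : ℝ) : ℝ :=
  -P - 2*s3*R - (P^2-R^2)/2 - s3*P*R + 2*C + 5*C*(P+s3*R)/2 - 3*C^2
/-- imaginary part of `u ∂_u J6 / 6` -/
def E2 (P R C : ℝ) : ℝ :=
  2*s3*P - R - P*R + s3*(P^2-R^2)/2 + 3*C*(R-s3*P)/2

/-- critical points -/
def Crit (p : ℝ × ℝ) : Prop := pdx J6 p = 0 ∧ pdy J6 p = 0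

lemma crit_zero : Crit (0, 0) := by
  constructor
  · rw [pdx_eq]; simp [DG]
  · rw [pdy_eq]; simp [DG]

lemma crit_iff (x y : ℝ) (h : CC x y ≠ 0) : Crit (x, y) ↔
    E1 (PP x y) (RR x y) (CC x y) = 0 ∧ E2 (PP x y) (RR x y) (CC x y) = 0 := by
  have k1 : x * pdx J6 (x,y) + y * pdy J6 (x,y) = 12 * E1 (PP x y) (RR x y) (CC x y) := by
    rw [pdx_eq, pdy_eq]; unfold DG E1 PP RR CC; ring
  have k2 : y * pdx J6 (x,y) - x * pdy J6 (x,y) = 12 * E2 (PP x y) (RR x y) (CC x y) := by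
    rw [pdx_eq, pdy_eq]; unfold DG E2 PP RR CC; ring
  unfold Crit
  constructor
  · rintro ⟨h1, h2⟩
    rw [h1, h2] at k1 k2
    constructor <;> linarith
  · rintro ⟨h1, h2⟩
    rw [h1] at k1
    rw [h2] at k2
    have a1 : CC x y * pdx J6 (x,y) = 0 := by
      unfold CC; linear_combination x * k1 + y * k2
    have a2 : CC x y * pdy J6 (x,y) = 0 := by
      unfold CC; linear_combination y * k1 - x * k2
    exact ⟨(mul_eq_zero.1 a1).resolve_left h, (mul_eq_zero.1 a2).resolve_left h⟩

/-- cubing map -/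
def cube (p : ℝ × ℝ) : ℝ × ℝ := (PP p.1 p.2, RR p.1 p.2)

open Classical in
/-- cubes of points with value `0` -/
def T0 : Finset (ℝ × ℝ) := {(-1/2, s3/2), ((7-4*s3)/2, (2-s3)/2), (17/2-3*s3, s3/2),
  ((7+4*s3)/2, -(2+s3)/2), (17/2+3*s3, s3/2)}
open Classical in
/-- cubes of nonzero points with value `-1` -/
def T1 : Finset (ℝ × ℝ) := {(1/2, s3/2), (8, 0)}
open Classical in
/-- cubes of points with value `8` -/
def T8 : Finset (ℝ × ℝ) := {(1/2, -s3/2)}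

lemma card_T0 : T0.card = 5 := by
  have h1 := s3_lo
  have h2 := s3_hi
  unfold T0
  repeat rw [Finset.card_insert_of_notMem]
  · simp
  all_goals
    simp only [Finset.mem_insert, Finset.mem_singleton, Prod.mk.injEq, not_or, not_and]
    refine_lift ?_
    repeat' constructor
    all_goals
      intro h
      exfalso
      linarith

lemma card_T1 : T1.card = 2 := by
  unfold T1
  rw [Finset.card_insert_of_notMem]
  · simp
  · simp; norm_num

lemma card_T8 : T8.card = 1 := by simp [T8]

lemma solve (P R C : ℝ) (hC : C ≠ 0) (h : P^2 + R^2 = C^3) (h1 : E1 P R C = 0)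
    (h2 : E2 P R C = 0) : (P, R) ∈ T0 ∨ (P, R) ∈ T1 ∨ (P, R) ∈ T8 := by
  have hs := s3_sq
  have hs0 := s3_pos
  obtain ⟨q, rfl⟩ : ∃ q, R = s3 * q := ⟨R / s3, by field_simp⟩
  have g1 : -P -6*q - (P^2-3*q^2)/2 - 3*P*q + 2*C + 5*C*(P+3*q)/2 - 3*C^2 = 0 := by
    unfold E1 at h1
    linear_combination h1 + (2*q - q^2/2 + P*q - 5*C*q/2) * hs
  have g2 : 2*P - q - P*q + (P^2-3*q^2)/2 + 3*C*(q-P)/2=0 := by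
    unfold E2 at h2
    apply mul_left_cancel₀ hs0.ne'
    linear_combination h2 + s3*(q^2/2) * hs
  have g3 : P^2+3*q^2=C^3 := by linear_combination h - q^2*hs
  have := elim P q C hC g1 g2 g3
  rw [mul_eq_zero, mul_eq_zero, mul_eq_zero] at this
  simp only [T0, T1, T8, Finset.mem_insert, Finset.mem_singleton, Prod.mk.injEq]
  rcases this with hq | (hq | hq) | hq
  · have := qd P C hC q hq g1 g2 g3
    subst this; subst hq; simp
  · have := qa P C hC q hq g1 g2 g3
    have hq' : q = 1/2 := by linarith
    subst hq'
    rw [mul_eq_zero, mul_eq_zero] at this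
    have e : s3 * (1/2) = s3/2 := by ring
    rcases this with h | h | h
    · have : P = 1/2 := by linarith
      exact Or.inr (Or.inl (Or.inl ⟨this, e⟩))
    · have : P = -1/2 := by linarith
      exact Or.inl (Or.inl ⟨this, e⟩)
    · have : (2*P-17-6*s3)*(2*P-17+6*s3) = 0 := by linear_combination h - 36*hs
      rcases mul_eq_zero.1 this with h | h
      · have : P = 17/2+3*s3 := by linarith
        exact Or.inl (Or.inr (Or.inr (Or.inr (Or.inr ⟨this, e⟩))))
      · have : P = 17/2-3*s3 := by linarith
        exact Or.inl (Or.inr (Or.inr (Or.inl ⟨this, e⟩)))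
  · have := qb P C hC q hq g1 g2 g3
    have hq' : q = -1/2 := by linarith
    subst hq'
    exact Or.inr (Or.inr ⟨by linarith, by ring⟩)
  · have hP := qc P C hC q hq g1 g2 g3
    have : (q + 1/2 - s3/3)*(q+1/2+s3/3) = 0 := by linear_combination hq/12 - hs/9
    rcases mul_eq_zero.1 this with h | h
    · have hq' : q = -1/2 + s3/3 := by linarith
      refine Or.inl (Or.inr (Or.inl ⟨by linarith, ?_⟩))
      rw [hq']; linear_combination hs/3
    · have hq' : q = -1/2 - s3/3 := by linarith
      refine Or.inl (Or.inr (Or.inr (Or.inr (Or.inl ⟨by linarith, ?_⟩))))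
      rw [hq']; linear_combination -hs/3

/-- good triple with a given value -/
lemma back (x y P R C V : ℝ) (hP : PP x y = P) (hR : RR x y = R) (hC : 0 < C)
    (h : P^2 + R^2 = C^3) (h1 : E1 P R C = 0) (h2 : E2 P R C = 0) (hV : GG P R C = V) :
    Crit (x, y) ∧ J6 (x, y) = V := by
  have hn := norm_rel x y
  rw [hP, hR, h] at hn
  have h0 : 0 ≤ CC x y := by unfold CC; positivity
  have hc : CC x y = C := ((pow_left_inj₀ hC.le h0 (by norm_num)).1 hn).symm
  refine ⟨(crit_iff x y (by rw [hc]; exact hC.ne')).2 ?_, ?_⟩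
  · rw [hP, hR, hc]; exact ⟨h1, h2⟩
  · rw [J6_eq, hP, hR, hc]; exact hV

lemma back0 (p : ℝ × ℝ) (hp : cube p ∈ T0) : Crit p ∧ J6 p = 0 := by
  obtain ⟨x, y⟩ := p
  have hs := s3_sq
  have hl := s3_lo
  have hh := s3_hi
  simp only [cube, T0, Finset.mem_insert, Finset.mem_singleton, Prod.mk.injEq] at hp
  rcases hp with ⟨a, b⟩ | ⟨a, b⟩ | ⟨a, b⟩ | ⟨a, b⟩ | ⟨a, b⟩
  · apply back x y _ _ 1 _ a b <;> (try unfold E1) <;> (try unfold E2) <;> (try unfold GG) <;> grind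
  · apply back x y _ _ (2-s3) _ a b <;> (try unfold E1) <;> (try unfold E2) <;> (try unfold GG) <;> grind
  · apply back x y _ _ (4-s3) _ a b <;> (try unfold E1) <;> (try unfold E2) <;> (try unfold GG) <;> grind
  · apply back x y _ _ (2+s3) _ a b <;> (try unfold E1) <;> (try unfold E2) <;> (try unfold GG) <;> grind
  · apply back x y _ _ (4+s3) _ a b <;> (try unfold E1) <;> (try unfold E2) <;> (try unfold GG) <;> grind

lemma back1 (p : ℝ × ℝ) (hp : cube p ∈ T1) : Crit p ∧ J6 p = -1 := by
  obtain ⟨x, y⟩ := p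
  have hs := s3_sq
  simp only [cube, T1, Finset.mem_insert, Finset.mem_singleton, Prod.mk.injEq] at hp
  rcases hp with ⟨a, b⟩ | ⟨a, b⟩
  · apply back x y _ _ 1 _ a b <;> (try unfold E1) <;> (try unfold E2) <;> (try unfold GG) <;> grind
  · apply back x y _ _ 4 _ a b <;> (try unfold E1) <;> (try unfold E2) <;> (try unfold GG) <;> grind

lemma back8 (p : ℝ × ℝ) (hp : cube p ∈ T8) : Crit p ∧ J6 p = 8 := by
  obtain ⟨x, y⟩ := p
  have hs := s3_sq
  simp only [cube, T8, Finset.mem_singleton, Prod.mk.injEq] at hp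
  obtain ⟨a, b⟩ := hp
  apply back x y _ _ 1 _ a b <;> (try unfold E1) <;> (try unfold E2) <;> (try unfold GG) <;> grind

lemma J6_zero : J6 (0, 0) = -1 := by
  rw [J6_eq]; simp [GG, PP, RR, CC]

lemma crit_cases (p : ℝ × ℝ) (h : Crit p) :
    p = (0, 0) ∨ cube p ∈ T0 ∨ cube p ∈ T1 ∨ cube p ∈ T8 := by
  obtain ⟨x, y⟩ := p
  by_cases hC : CC x y = 0
  · left
    unfold CC at hC
    have hx : x = 0 := by nlinarith [sq_nonneg x, sq_nonneg y]
    have hy : y = 0 := by nlinarith [sq_nonneg x, sq_nonneg y]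
    rw [hx, hy]
  · right
    obtain ⟨h1, h2⟩ := (crit_iff x y hC).1 h
    exact solve _ _ _ hC (norm_rel x y) h1 h2

/-- A nonzero point has exactly three cube roots. -/
lemma cube_fiber (t : ℝ × ℝ) (ht : t ≠ (0, 0)) :
    {p | cube p = t}.Finite ∧ {p | cube p = t}.ncard = 3 := by
  have hs := s3_sq
  have hs0 := s3_pos
  obtain ⟨z, hz⟩ := IsAlgClosed.exists_pow_nat_eq (⟨t.1, t.2⟩ : ℂ) (n := 3) (by norm_num)
  obtain ⟨a, b⟩ := z
  obtain ⟨P, R⟩ := t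
  have hre := congrArg Complex.re hz
  have him := congrArg Complex.im hz
  simp [pow_succ] at hre him
  have hP : PP a b = P := by unfold PP; linarith
  have hR : RR a b = R := by unfold RR; linarith
  have hne : ¬ (a = 0 ∧ b = 0) := by
    rintro ⟨rfl, rfl⟩
    apply ht
    rw [← hP, ← hR]; simp [PP, RR]
  have hpos : 0 < a^2 + b^2 := by
    by_contra hc
    exact hne ⟨by nlinarith [sq_nonneg a, sq_nonneg b], by nlinarith [sq_nonneg a, sq_nonneg b]⟩
  have key : {p | cube p = (P, R)} = {(a, b), (-a/2 - s3*b/2, -b/2 + s3*a/2),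
      (-a/2 + s3*b/2, -b/2 - s3*a/2)} := by
    ext ⟨x, y⟩
    simp only [Set.mem_ofPred_eq, Set.mem_insert_iff, Set.mem_singleton_iff, cube, Prod.mk.injEq]
    constructor
    · rintro ⟨h1, h2⟩
      rw [← hP] at h1
      rw [← hR] at h2
      have hc : (⟨x, y⟩ - ⟨a, b⟩ : ℂ) * ((⟨x, y⟩ - ⟨-a/2 - s3*b/2, -b/2 + s3*a/2⟩) *
          (⟨x, y⟩ - ⟨-a/2 + s3*b/2, -b/2 - s3*a/2⟩)) = 0 := by
        simp only [PP, RR] at h1 h2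
        apply Complex.ext
        · simp
          grind
        · simp
          grind
      rw [mul_eq_zero, mul_eq_zero, sub_eq_zero, sub_eq_zero, sub_eq_zero] at hc
      simpa [Complex.ext_iff] using hc
    · simp only [PP, RR] at *
      rintro (⟨rfl, rfl⟩ | ⟨rfl, rfl⟩ | ⟨rfl, rfl⟩)
      · exact ⟨hP, hR⟩
      · constructor <;> grind
      · constructor <;> grind
  rw [key]
  refine ⟨by simp, ?_⟩
  rw [Set.ncard_eq_three]
  refine ⟨_, _, _, ?_, ?_, ?_, rfl⟩
  · simp only [ne_eq, Prod.mk.injEq]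
    rintro ⟨h1, h2⟩
    nlinarith
  · simp only [ne_eq, Prod.mk.injEq]
    rintro ⟨h1, h2⟩
    nlinarith
  · simp only [ne_eq, Prod.mk.injEq]
    rintro ⟨h1, h2⟩
    apply hne
    constructor
    · apply mul_left_cancel₀ hs0.ne'; linarith
    · apply mul_left_cancel₀ hs0.ne'; linarith

open Classical in
lemma cube_count (T : Finset (ℝ × ℝ)) (hT : ((0, 0) : ℝ × ℝ) ∉ T) :
    {p | cube p ∈ T}.Finite ∧ {p | cube p ∈ T}.ncard = 3 * T.card := by
  induction T using Finset.induction_on with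
  | empty => simp
  | insert t T htT ih =>
    rw [Finset.mem_insert, not_or] at hT
    obtain ⟨f1, n1⟩ := ih hT.2
    obtain ⟨f2, n2⟩ := cube_fiber t (Ne.symm hT.1)
    have e : {p | cube p ∈ insert t T} = {p | cube p = t} ∪ {p | cube p ∈ T} := by
      ext p; simp
    rw [e, Finset.card_insert_of_notMem htT, Set.ncard_union_eq _ f2 f1, n1, n2]
    · exact ⟨f2.union f1, by ring⟩
    · rw [Set.disjoint_left]
      intro p hp hp'
      simp only [Set.mem_ofPred_eq] at hp hp'
      rw [hp] at hp'
      exact htT hp'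

lemma zero_T0 : ((0, 0) : ℝ × ℝ) ∉ T0 := by
  intro h
  have h0 : cube (0, 0) ∈ T0 := by simpa [cube, PP, RR] using h
  have := (back0 _ h0).2
  rw [J6_zero] at this
  norm_num at this

lemma zero_T1 : ((0, 0) : ℝ × ℝ) ∉ T1 := by simp [T1]

lemma zero_T8 : ((0, 0) : ℝ × ℝ) ∉ T8 := by simp [T8]

lemma set0 : {p : ℝ × ℝ | Crit p ∧ J6 p = 0} = {p | cube p ∈ T0} := by
  ext p
  refine ⟨fun ⟨h, hv⟩ => ?_, back0 p⟩
  rcases crit_cases p h with h | h | h | h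
  · rw [h, J6_zero] at hv; norm_num at hv
  · exact h
  · rw [(back1 p h).2] at hv; norm_num at hv
  · rw [(back8 p h).2] at hv; norm_num at hv

lemma set1 : {p : ℝ × ℝ | Crit p ∧ J6 p = -1} = insert (0, 0) {p | cube p ∈ T1} := by
  ext p
  constructor
  · rintro ⟨h, hv⟩
    rcases crit_cases p h with h | h | h | h
    · exact Or.inl h
    · rw [(back0 p h).2] at hv; norm_num at hv
    · exact Or.inr h
    · rw [(back8 p h).2] at hv; norm_num at hv
  · rintro (h | h)
    · rw [h]; exact ⟨crit_zero, J6_zero⟩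
    · exact back1 p h

lemma set8 : {p : ℝ × ℝ | Crit p ∧ J6 p = 8} = {p | cube p ∈ T8} := by
  ext p
  refine ⟨fun ⟨h, hv⟩ => ?_, back8 p⟩
  rcases crit_cases p h with h | h | h | h
  · rw [h, J6_zero] at hv; norm_num at hv
  · rw [(back0 p h).2] at hv; norm_num at hv
  · rw [(back1 p h).2] at hv; norm_num at hv
  · exact h

lemma vals (p : ℝ × ℝ) (h : Crit p) : J6 p = 0 ∨ J6 p = -1 ∨ J6 p = 8 := by
  rcases crit_cases p h with h | h | h | h
  · rw [h]; exact Or.inr (Or.inl J6_zero)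
  · exact Or.inl (back0 p h).2
  · exact Or.inr (Or.inl (back1 p h).2)
  · exact Or.inr (Or.inr (back8 p h).2)

/-- `J6` has exactly 25 critical points; every critical value is `0`, `-1` or `8`;
exactly 15 critical points have value `0`, exactly 7 have value `-1` and exactly 3
have value `8`. -/
theorem stmt :
    {p : ℝ × ℝ | pdx J6 p = 0 ∧ pdy J6 p = 0}.Finite ∧
    {p : ℝ × ℝ | pdx J6 p = 0 ∧ pdy J6 p = 0}.ncard = 25 ∧
    (∀ p : ℝ × ℝ, pdx J6 p = 0 ∧ pdy J6 p = 0 →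
      J6 p = 0 ∨ J6 p = -1 ∨ J6 p = 8) ∧
    {p : ℝ × ℝ | (pdx J6 p = 0 ∧ pdy J6 p = 0) ∧ J6 p = 0}.ncard = 15 ∧
    {p : ℝ × ℝ | (pdx J6 p = 0 ∧ pdy J6 p = 0) ∧ J6 p = -1}.ncard = 7 ∧
    {p : ℝ × ℝ | (pdx J6 p = 0 ∧ pdy J6 p = 0) ∧ J6 p = 8}.ncard = 3 := by
  have c0 : {p : ℝ × ℝ | Crit p ∧ J6 p = 0}.Finite ∧
      {p : ℝ × ℝ | Crit p ∧ J6 p = 0}.ncard = 15 := by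
    rw [set0]
    have := cube_count T0 zero_T0
    rwa [card_T0] at this
  have c1 : {p : ℝ × ℝ | Crit p ∧ J6 p = -1}.Finite ∧
      {p : ℝ × ℝ | Crit p ∧ J6 p = -1}.ncard = 7 := by
    rw [set1]
    obtain ⟨f, n⟩ := cube_count T1 zero_T1
    refine ⟨f.insert _, ?_⟩
    rw [Set.ncard_insert_of_notMem _ f, n, card_T1]
    intro h
    apply zero_T1
    simpa [cube, PP, RR] using h
  have c8 : {p : ℝ × ℝ | Crit p ∧ J6 p = 8}.Finite ∧
      {p : ℝ × ℝ | Crit p ∧ J6 p = 8}.ncard = 3 := by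
    rw [set8]
    have := cube_count T8 zero_T8
    rwa [card_T8] at this
  have e : {p : ℝ × ℝ | Crit p} = {p | Crit p ∧ J6 p = 0} ∪
      ({p | Crit p ∧ J6 p = -1} ∪ {p | Crit p ∧ J6 p = 8}) := by
    ext p
    have := vals p
    simp only [Set.mem_ofPred_eq, Set.mem_union]
    tauto
  have ct : {p : ℝ × ℝ | Crit p}.Finite ∧ {p : ℝ × ℝ | Crit p}.ncard = 25 := by
    rw [e]
    refine ⟨c0.1.union (c1.1.union c8.1), ?_⟩
    rw [Set.ncard_union_eq _ c0.1 (c1.1.union c8.1), Set.ncard_union_eq _ c1.1 c8.1,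
      c0.2, c1.2, c8.2]
    · rw [Set.disjoint_left]
      rintro p ⟨_, h⟩ ⟨_, h'⟩
      rw [h] at h'; norm_num at h'
    · rw [Set.disjoint_left]
      rintro p ⟨_, h⟩ (⟨_, h'⟩ | ⟨_, h'⟩) <;> · rw [h] at h'; norm_num at h'
  exact ⟨ct.1, ct.2, vals, c0.2, c1.2, c8.2⟩
end
end

section
/- Regard the real polynomial J₉(x,y) = −1 + 2·Re(j₉(x+iy, x−iy)), with j₉(u,v) = (9−27b)u³ − 9b·u⁶ − b·u⁹ + (27/2)uv − (9−54b)u⁴v + 9b·u⁷v − 27u²v² − 27b·u⁵v² + 15u³v³ and b = exp(−iπ/3), as a polynomial in ℂ[x,y]. Then the Milnor algebra ℂ[x,y]/⟨∂J₉/∂x, ∂J₉/∂y⟩ is a complex vector space of dimension 64, i.e. the total Milnor number of J₉ is 64. -/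
noncomputable section

/-- The polynomial `j9(u,v)`. -/
def j9 (u v : ℂ) : ℂ := (9 - 27*bC)*u^3 - 9*bC*u^6 - bC*u^9 + (27/2)*u*v - (9 - 54*bC)*u^4*v + 9*bC*u^7*v - 27*u^2*v^2 - 27*bC*u^5*v^2 + 15*u^3*v^3


open MvPolynomial in
/-- The monomial `X₀^i X₁^j`. -/
def mon (k : ℕ × ℕ) : MvPolynomial (Fin 2) ℂ := X 0 ^ k.1 * X 1 ^ k.2

/-- Exponents in two variables, as pairs. -/
def expEquiv : (Fin 2 →₀ ℕ) ≃ ℕ × ℕ :=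
  Finsupp.equivFunOnFinite.trans (finTwoArrowEquiv ℕ)

open MvPolynomial in
/-- The monomial basis. -/
def monB : Module.Basis (ℕ × ℕ) ℂ (MvPolynomial (Fin 2) ℂ) :=
  (basisMonomials (Fin 2) ℂ).reindex expEquiv

open MvPolynomial in
lemma monB_apply (k : ℕ × ℕ) : monB k = mon k := by
  rw [monB, Module.Basis.reindex_apply, coe_basisMonomials, mon]
  change monomial _ _ = _
  rw [monomial_eq]
  simp [Finsupp.prod_fintype, expEquiv]

lemma monB_eq : (monB : ℕ × ℕ → MvPolynomial (Fin 2) ℂ) = mon := funext monB_apply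

lemma mon_mul (k l : ℕ × ℕ) : mon k * mon l = mon (k.1 + l.1, k.2 + l.2) := by
  simp only [mon, pow_add]; ring

/-- Polynomials of total degree less than `n`. -/
def degLT (n : ℕ) : Submodule ℂ (MvPolynomial (Fin 2) ℂ) :=
  Submodule.span ℂ (mon '' {k | k.1 + k.2 < n})

lemma mon_mem {n : ℕ} {k : ℕ × ℕ} (h : k.1 + k.2 < n) : mon k ∈ degLT n :=
  Submodule.subset_span ⟨k, h, rfl⟩

lemma degLT_zero : degLT 0 = ⊥ := by simp [degLT]

lemma degLT_mono {m n : ℕ} (h : m ≤ n) : degLT m ≤ degLT n := by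
  refine Submodule.span_mono (Set.image_mono ?_)
  intro k hk
  simp only [Set.mem_ofPred_eq] at hk ⊢
  omega

lemma span_mon : Submodule.span ℂ (Set.range mon) = ⊤ := by
  rw [← monB_eq]; exact monB.span_eq

lemma exists_degLT (p : MvPolynomial (Fin 2) ℂ) : ∃ n, p ∈ degLT n := by
  have hp : p ∈ Submodule.span ℂ (Set.range mon) := by rw [span_mon]; trivial
  induction hp using Submodule.span_induction with
  | mem x hx => obtain ⟨k, rfl⟩ := hx; exact ⟨k.1 + k.2 + 1, mon_mem (by omega)⟩
  | zero => exact ⟨0, zero_mem _⟩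
  | add x y _ _ hx hy =>
    obtain ⟨a, ha⟩ := hx
    obtain ⟨b, hb⟩ := hy
    exact ⟨max a b, add_mem (degLT_mono (le_max_left _ _) ha) (degLT_mono (le_max_right _ _) hb)⟩
  | smul c x _ hx => obtain ⟨a, ha⟩ := hx; exact ⟨a, Submodule.smul_mem _ _ ha⟩

lemma mon_mul_mem (k : ℕ × ℕ) {n : ℕ} {r : MvPolynomial (Fin 2) ℂ} (hr : r ∈ degLT n) :
    mon k * r ∈ degLT (k.1 + k.2 + n) := by
  induction hr using Submodule.span_induction with
  | mem x hx =>
    obtain ⟨l, hl, rfl⟩ := hx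
    rw [mon_mul]
    simp only [Set.mem_ofPred_eq] at hl
    exact mon_mem (by simp only; omega)
  | zero => simp
  | add x y _ _ hx hy => rw [mul_add]; exact add_mem hx hy
  | smul c x _ hx => rw [mul_smul_comm]; exact Submodule.smul_mem _ _ hx

/-- A linear map that is the identity up to terms of lower degree is bijective. -/
lemma bijective_of_degLT (T : MvPolynomial (Fin 2) ℂ →ₗ[ℂ] MvPolynomial (Fin 2) ℂ)
    (hT : ∀ k : ℕ × ℕ, T (mon k) - mon k ∈ degLT (k.1 + k.2)) : Function.Bijective T := by
  have key : ∀ n, ∀ p ∈ degLT (n + 1), T p - p ∈ degLT n := by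
    intro n p hp
    induction hp using Submodule.span_induction with
    | mem x hx =>
      obtain ⟨l, hl, rfl⟩ := hx
      simp only [Set.mem_ofPred_eq] at hl
      exact degLT_mono (by omega) (hT l)
    | zero => simp
    | add x y _ _ hx hy =>
      rw [map_add, add_sub_add_comm]; exact add_mem hx hy
    | smul c x _ hx => rw [map_smul, ← smul_sub]; exact Submodule.smul_mem _ _ hx
  constructor
  · rw [injective_iff_map_eq_zero]
    have : ∀ n, ∀ p ∈ degLT n, T p = 0 → p = 0 := by
      intro n
      induction n with
      | zero => intro p hp _; simpa [degLT_zero] using hp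
      | succ n ih =>
        intro p hp h0
        refine ih p ?_ h0
        have := key n p hp
        rw [h0, zero_sub] at this
        simpa using this
    intro p
    obtain ⟨n, hn⟩ := exists_degLT p
    exact this n p hn
  · have : ∀ n, ∀ p ∈ degLT n, p ∈ LinearMap.range T := by
      intro n
      induction n with
      | zero => intro p hp; rw [degLT_zero, Submodule.mem_bot] at hp; rw [hp]; exact zero_mem _
      | succ n ih =>
        intro p hp
        have h1 := ih _ (key n p hp)
        have h2 : p = T p - (T p - p) := by abel
        rw [h2]
        exact sub_mem ⟨p, rfl⟩ h1
    intro p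
    obtain ⟨n, hn⟩ := exists_degLT p
    exact this n p hn

/-- The images of the monomials under the triangular map. -/
def tri (P Q : MvPolynomial (Fin 2) ℂ) (k : ℕ × ℕ) : MvPolynomial (Fin 2) ℂ :=
  if 8 ≤ k.2 then mon (k.1, k.2 - 8) * Q
  else if 8 ≤ k.1 then mon (k.1 - 8, k.2) * P else mon k

/-- The triangular map. -/
def triMap (P Q : MvPolynomial (Fin 2) ℂ) :
    MvPolynomial (Fin 2) ℂ →ₗ[ℂ] MvPolynomial (Fin 2) ℂ :=
  monB.constr ℂ (tri P Q)

lemma triMap_mon (P Q : MvPolynomial (Fin 2) ℂ) (k : ℕ × ℕ) :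
    triMap P Q (mon k) = tri P Q k := by
  rw [← monB_apply, triMap, Module.Basis.constr_basis]

/-- Span of the monomials outside of the box. -/
def offBox : Submodule ℂ (MvPolynomial (Fin 2) ℂ) :=
  Submodule.span ℂ (mon '' {k | 8 ≤ k.1 ∨ 8 ≤ k.2})

/-- Box coordinates. -/
def boxCoord : MvPolynomial (Fin 2) ℂ →ₗ[ℂ] (Fin 8 × Fin 8 → ℂ) :=
  LinearMap.pi fun k => monB.coord (k.1.val, k.2.val)

lemma ker_boxCoord : LinearMap.ker boxCoord = offBox := by
  ext p
  rw [offBox, ← monB_eq, Module.Basis.mem_span_image, LinearMap.mem_ker]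
  constructor
  · intro h k hk
    by_contra hc
    simp only [Set.mem_ofPred_eq, not_or, not_le] at hc
    have := congrFun h (⟨k.1, hc.1⟩, ⟨k.2, hc.2⟩)
    simp only [boxCoord, LinearMap.pi_apply, Module.Basis.coord_apply, Pi.zero_apply] at this
    simp at hk
    exact hk this
  · intro h
    ext k
    simp only [boxCoord, LinearMap.pi_apply, Module.Basis.coord_apply, Pi.zero_apply]
    by_contra hc
    have := h (Finset.mem_coe.2 (Finsupp.mem_support_iff.2 hc))
    simp only [Set.mem_ofPred_eq] at this
    omega

lemma boxCoord_surj : Function.Surjective boxCoord := by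
  intro f
  refine ⟨∑ k : Fin 8 × Fin 8, f k • monB (k.1.val, k.2.val), ?_⟩
  ext l
  simp only [boxCoord, LinearMap.pi_apply, map_sum, map_smul, Module.Basis.coord_apply,
    Module.Basis.repr_self, smul_eq_mul]
  rw [Finset.sum_eq_single l]
  · simp
  · intro k _ hk
    rw [Finsupp.single_apply, if_neg, mul_zero]
    intro h
    apply hk
    simp only [Prod.mk.injEq] at h
    exact Prod.ext (Fin.ext h.1) (Fin.ext h.2)
  · simp

open MvPolynomial in
lemma ideal_eq (P Q : MvPolynomial (Fin 2) ℂ) (hQ : Q - mon (0, 8) ∈ degLT 8) :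
    (Ideal.span ({P, Q} : Set (MvPolynomial (Fin 2) ℂ))).restrictScalars ℂ =
      offBox.map (triMap P Q) := by
  have hQm : ∀ f, Q * f ∈ offBox.map (triMap P Q) := by
    intro f
    have hf : f ∈ Submodule.span ℂ (Set.range mon) := by rw [span_mon]; trivial
    induction hf using Submodule.span_induction with
    | mem x hx =>
      obtain ⟨k, rfl⟩ := hx
      refine ⟨mon (k.1, k.2 + 8), Submodule.subset_span ⟨_, Or.inr (by simp), rfl⟩, ?_⟩
      rw [triMap_mon, tri, if_pos (by simp)]
      simp [mul_comm]
    | zero => simp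
    | add x y _ _ hx hy => rw [mul_add]; exact add_mem hx hy
    | smul c x _ hx => rw [mul_smul_comm]; exact Submodule.smul_mem _ _ hx
  have hPm : ∀ n, ∀ f ∈ degLT n, P * f ∈ offBox.map (triMap P Q) := by
    intro n
    induction n with
    | zero => intro f hf; rw [degLT_zero, Submodule.mem_bot] at hf; simp [hf]
    | succ n ih =>
      intro f hf
      induction hf using Submodule.span_induction with
      | mem x hx =>
        obtain ⟨k, hk, rfl⟩ := hx
        simp only [Set.mem_ofPred_eq] at hk
        by_cases h8 : 8 ≤ k.2
        · have h1 : mon k = mon (k.1, k.2 - 8) * mon (0, 8) := by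
            rw [mon_mul]; congr 1; ext <;> simp; omega
          have h2 : P * mon k = Q * (P * mon (k.1, k.2 - 8)) -
              P * (mon (k.1, k.2 - 8) * (Q - mon (0, 8))) := by rw [h1]; ring
          rw [h2]
          refine sub_mem (hQm _) (ih _ ?_)
          exact degLT_mono (by simp only; omega) (mon_mul_mem _ hQ)
        · refine ⟨mon (k.1 + 8, k.2), Submodule.subset_span ⟨_, Or.inl (by simp), rfl⟩, ?_⟩
          rw [triMap_mon, tri, if_neg (by simpa using h8), if_pos (by simp)]
          simp [mul_comm]
      | zero => simp
      | add x y _ _ hx hy => rw [mul_add]; exact add_mem hx hy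
      | smul c x _ hx => rw [mul_smul_comm]; exact Submodule.smul_mem _ _ hx
  apply le_antisymm
  · intro f hf
    rw [Submodule.restrictScalars_mem, Ideal.mem_span_pair] at hf
    obtain ⟨a, b, rfl⟩ := hf
    obtain ⟨n, hn⟩ := exists_degLT a
    rw [mul_comm a, mul_comm b]
    exact add_mem (hPm n a hn) (hQm b)
  · rw [offBox, Submodule.map_span, Submodule.span_le]
    rintro _ ⟨_, ⟨k, hk, rfl⟩, rfl⟩
    rw [triMap_mon, tri]
    rw [SetLike.mem_coe, Submodule.restrictScalars_mem]
    split_ifs with h1 h2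
    · exact Ideal.mul_mem_left _ _ (Ideal.subset_span (by simp))
    · exact Ideal.mul_mem_left _ _ (Ideal.subset_span (by simp))
    · simp only [Set.mem_ofPred_eq] at hk; omega

lemma finrank_quot (P Q : MvPolynomial (Fin 2) ℂ) (hP : P - mon (8, 0) ∈ degLT 8)
    (hQ : Q - mon (0, 8) ∈ degLT 8) :
    Module.finrank ℂ (MvPolynomial (Fin 2) ℂ ⧸
      Ideal.span ({P, Q} : Set (MvPolynomial (Fin 2) ℂ))) = 64 := by
  have hbij : Function.Bijective (triMap P Q) := by
    apply bijective_of_degLT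
    intro k
    rw [triMap_mon, tri]
    split_ifs with h1 h2
    · have : mon k = mon (k.1, k.2 - 8) * mon (0, 8) := by
        rw [mon_mul]; congr 1; ext <;> simp; omega
      rw [this, ← mul_sub]
      exact degLT_mono (by simp only; omega) (mon_mul_mem _ hQ)
    · have : mon k = mon (k.1 - 8, k.2) * mon (8, 0) := by
        rw [mon_mul]; congr 1; ext <;> simp; omega
      rw [this, ← mul_sub]
      exact degLT_mono (by simp only; omega) (mon_mul_mem _ hP)
    · simp
  let e := LinearEquiv.ofBijective (triMap P Q) hbij
  let e1 := Submodule.Quotient.equiv offBox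
    ((Ideal.span ({P, Q} : Set (MvPolynomial (Fin 2) ℂ))).restrictScalars ℂ) e
    (by rw [ideal_eq P Q hQ]; rfl)
  have e2 := LinearMap.quotKerEquivOfSurjective boxCoord boxCoord_surj
  rw [ker_boxCoord] at e2
  have e3 := Submodule.Quotient.restrictScalarsEquiv ℂ
    (Ideal.span ({P, Q} : Set (MvPolynomial (Fin 2) ℂ)))
  have := (e3.symm.trans (e1.symm.trans e2)).finrank_eq
  rw [this, Module.finrank_fintype_fun_eq_card]
  simp

open MvPolynomial in
lemma bC_mul_conj : bC * (starRingEnd ℂ) bC = 1 := by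
  rw [bC, ← Complex.exp_conj, ← Complex.exp_add, ← Complex.exp_zero]
  congr 1
  have h3 : (starRingEnd ℂ) (3 : ℂ) = 3 := Complex.conj_ofNat 3
  simp [Complex.conj_ofReal, h3]

section poly
variable {R : Type*} [CommRing R]

/-- `J₉` in the coordinates `u, v`. -/
def gG (b c u v : R) : R :=
  -1 + (9 - 27*b)*u^3 - 9*b*u^6 - b*u^9 + 27*u*v - (9 - 54*b)*u^4*v + 9*b*u^7*v - 54*u^2*v^2
    - 27*b*u^5*v^2 + 30*u^3*v^3
    + (9 - 27*c)*v^3 - 9*c*v^6 - c*v^9 - (9 - 54*c)*v^4*u + 9*c*v^7*u - 27*c*v^5*u^2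

/-- Normalised `u`-derivative. -/
def pp (c u v : R) : R :=
  u^8 + (9 - 3*c)*u^2 + 6*u^5 - 3*c*v + (4*c - 24)*u^3*v - 7*u^6*v + 12*c*u*v^2 + 15*u^4*v^2
    - 10*c*u^2*v^3 + (c - 6*c^2)*v^4 - c^2*v^7 + 6*c^2*v^5*u

lemma map_pp {S : Type*} [CommRing S] (F : R →+* S) (c u v : R) :
    F (pp c u v) = pp (F c) (F u) (F v) := by
  simp only [pp, map_add, map_sub, map_mul, map_pow, map_ofNat]

lemma span_aux (b c i h p q : R) (hbc : b * c = 1) (hI : i ^ 2 = -1) (h18 : h * 18 = 1) :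
    Ideal.span {-9 * b * p * 1 + -9 * c * q * 1, -9 * b * p * i + -9 * c * q * -i} =
      Ideal.span {p, q} := by
  apply le_antisymm
  · rw [Ideal.span_le]
    rintro f (rfl | rfl)
    · exact Ideal.mem_span_pair.2 ⟨-9 * b, -9 * c, by ring⟩
    · exact Ideal.mem_span_pair.2 ⟨-9 * b * i, 9 * c * i, by ring⟩
  · rw [Ideal.span_le]
    rintro f (rfl | rfl)
    · refine Ideal.mem_span_pair.2 ⟨-h * c, h * c * i, ?_⟩
      linear_combination 18 * h * f * hbc + f * h18 + (-9 * h * c * b * f + 9 * h * c * c * q) * hI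
    · refine Ideal.mem_span_pair.2 ⟨-h * b, -h * b * i, ?_⟩
      linear_combination 18 * h * f * hbc + f * h18 + (9 * h * b * b * p - 9 * h * c * b * f) * hI

end poly

open MvPolynomial in
lemma deriv_gG (D : Derivation ℂ (MvPolynomial (Fin 2) ℂ) (MvPolynomial (Fin 2) ℂ))
    (b c : ℂ) (hbc : b * c = 1) (u v : MvPolynomial (Fin 2) ℂ) :
    D (gG (C b) (C c) u v) =
      -9 * C b * pp (C c) u v * D u + -9 * C c * pp (C b) v u * D v := by
  have hbc' : (C b : MvPolynomial (Fin 2) ℂ) * C c = 1 := by rw [← C_mul, hbc, C_1]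
  have hn : ∀ n : ℕ, D (n : MvPolynomial (Fin 2) ℂ) = 0 := fun n => D.map_natCast n
  have h9 := hn 9
  have h27 := hn 27
  have h54 := hn 54
  have h30 := hn 30
  have hC : ∀ z : ℂ, D (C z) = 0 := fun z => D.map_algebraMap z
  push_cast at h9 h27 h54 h30
  simp only [gG, map_add, map_sub, map_neg, Derivation.leibniz, Derivation.leibniz_pow, hC, h9,
    h27, h54, h30, Derivation.map_one_eq_zero, smul_eq_mul, nsmul_eq_mul, mul_zero, zero_add,
    add_zero, sub_zero, neg_zero, Nat.add_one_sub_one]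
  push_cast
  simp only [pp]
  generalize C b = b at *
  generalize C c = c at *
  linear_combination
    (9 * (-3*u^2 - 3*v + 4*u^3*v + 12*u*v^2 - 10*u^2*v^3 + v^4
      + c * (-6*v^4 - v^7 + 6*v^5*u)) * D u
    + 9 * (-3*v^2 - 3*u + 4*v^3*u + 12*v*u^2 - 10*v^2*u^3 + u^4
      + b * (-6*u^4 - u^7 + 6*u^5*v)) * D v) * hbc'

open MvPolynomial in
lemma C_mon_mem (a : ℂ) {k : ℕ × ℕ} (h : k.1 + k.2 < 8) : C a * mon k ∈ degLT 8 := by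
  rw [← smul_eq_C_mul]; exact Submodule.smul_mem _ _ (mon_mem h)

open MvPolynomial in
lemma pp_mem (c : ℂ) : pp (C c) (X 0) (X 1) - mon (8, 0) ∈ degLT 8 := by
  have : pp (C c) (X 0) (X 1) - mon (8, 0) =
      C (9 - 3 * c) * mon (2, 0) + C 6 * mon (5, 0) + C (-3 * c) * mon (0, 1)
      + C (4 * c - 24) * mon (3, 1) + C (-7) * mon (6, 1) + C (12 * c) * mon (1, 2)
      + C 15 * mon (4, 2) + C (-10 * c) * mon (2, 3) + C (c - 6 * c ^ 2) * mon (0, 4)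
      + C (-c ^ 2) * mon (0, 7) + C (6 * c ^ 2) * mon (1, 5) := by
    simp only [pp, mon, map_sub, map_mul, map_neg, map_pow, map_ofNat]
    ring
  rw [this]
  repeat' apply add_mem
  all_goals exact C_mon_mem _ (by norm_num)

open MvPolynomial in
lemma pp_mem' (c : ℂ) : pp (C c) (X 1) (X 0) - mon (0, 8) ∈ degLT 8 := by
  have : pp (C c) (X 1) (X 0) - mon (0, 8) =
      C (9 - 3 * c) * mon (0, 2) + C 6 * mon (0, 5) + C (-3 * c) * mon (1, 0)
      + C (4 * c - 24) * mon (1, 3) + C (-7) * mon (1, 6) + C (12 * c) * mon (2, 1)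
      + C 15 * mon (2, 4) + C (-10 * c) * mon (3, 2) + C (c - 6 * c ^ 2) * mon (4, 0)
      + C (-c ^ 2) * mon (7, 0) + C (6 * c ^ 2) * mon (5, 1) := by
    simp only [pp, mon, map_sub, map_mul, map_neg, map_pow, map_ofNat]
    ring
  rw [this]
  repeat' apply add_mem
  all_goals exact C_mon_mem _ (by norm_num)

lemma C_I_sq : (MvPolynomial.C Complex.I : MvPolynomial (Fin 2) ℂ) ^ 2 = -1 := by
  rw [← map_pow, Complex.I_sq, map_neg, map_one]

lemma C_half : (MvPolynomial.C (1 / 2) : MvPolynomial (Fin 2) ℂ) * 2 = 1 := by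
  rw [← map_ofNat (MvPolynomial.C (σ := Fin 2) (R := ℂ)) 2, ← map_mul]; norm_num


open MvPolynomial in
/-- The linear change of coordinates. -/
def phi : MvPolynomial (Fin 2) ℂ ≃ₐ[ℂ] MvPolynomial (Fin 2) ℂ :=
  AlgEquiv.ofAlgHom (aeval ![X 0 + X 1 * C Complex.I, X 0 - X 1 * C Complex.I])
    (aeval ![C (1 / 2) * (X 0 + X 1), C (1 / 2) * C Complex.I * (X 1 - X 0)])
    (by
      have h1 := C_I_sq
      have h2 := C_half
      ext i : 1
      fin_cases i
      · simp only [Fin.zero_eta, AlgHom.comp_apply, aeval_X, Matrix.cons_val_zero, map_mul, map_add,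
          Matrix.cons_val_one, algHom_C, algebraMap_eq, AlgHom.id_apply]
        linear_combination X 0 * h2
      · simp only [Fin.mk_one, AlgHom.comp_apply, aeval_X, Matrix.cons_val_zero, map_mul, map_sub,
          Matrix.cons_val_one, algHom_C, algebraMap_eq, AlgHom.id_apply]
        linear_combination X 1 * h2 - 2 * C (1 / 2) * X 1 * h1)
    (by
      have h1 := C_I_sq
      have h2 := C_half
      ext i : 1
      fin_cases i
      · simp only [Fin.zero_eta, AlgHom.comp_apply, aeval_X, Matrix.cons_val_zero, map_mul, map_add,
          Matrix.cons_val_one, algHom_C, algebraMap_eq, AlgHom.id_apply]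
        linear_combination X 0 * h2 + C (1 / 2) * (X 1 - X 0) * h1
      · simp only [Fin.mk_one, AlgHom.comp_apply, aeval_X, Matrix.cons_val_zero, map_mul, map_sub,
          Matrix.cons_val_one, algHom_C, algebraMap_eq, AlgHom.id_apply]
        linear_combination X 1 * h2 - C (1 / 2) * (X 1 - X 0) * h1)

open MvPolynomial in
lemma phi_pp (c : ℂ) : phi (pp (C c) (X 0) (X 1)) =
    pp (C c) (X 0 + X 1 * C Complex.I) (X 0 - X 1 * C Complex.I) := by
  refine (map_pp (phi : MvPolynomial (Fin 2) ℂ →+* MvPolynomial (Fin 2) ℂ) _ _ _).trans ?_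
  simp [phi, algHom_C, algebraMap_eq]

open MvPolynomial in
lemma phi_pp' (c : ℂ) : phi (pp (C c) (X 1) (X 0)) =
    pp (C c) (X 0 - X 1 * C Complex.I) (X 0 + X 1 * C Complex.I) := by
  refine (map_pp (phi : MvPolynomial (Fin 2) ℂ →+* MvPolynomial (Fin 2) ℂ) _ _ _).trans ?_
  simp [phi, algHom_C, algebraMap_eq]

lemma j9_re (x y : ℝ) : -1 + 2 * ((j9 ((x : ℂ) + (y : ℂ) * Complex.I)
          ((x : ℂ) - (y : ℂ) * Complex.I)).re : ℂ) =
    gG bC ((starRingEnd ℂ) bC) ((x : ℂ) + (y : ℂ) * Complex.I)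
      ((x : ℂ) - (y : ℂ) * Complex.I) := by
  have h := Complex.add_conj (j9 ((x : ℂ) + (y : ℂ) * Complex.I) ((x : ℂ) - (y : ℂ) * Complex.I))
  push_cast at h
  rw [← h]
  have hn : ∀ n : ℕ, (starRingEnd ℂ) (n : ℂ) = n := fun n => map_natCast _ n
  have h2 := hn 2
  have h9 := hn 9
  have h15 := hn 15
  have h27 := hn 27
  have h54 := hn 54
  push_cast at h2 h9 h15 h27 h54
  simp only [j9, map_add, map_sub, map_mul, map_pow, map_div₀, Complex.conj_ofReal,
    Complex.conj_I, h2, h9, h15, h27, h54, gG, mul_neg, sub_neg_eq_add, ← sub_eq_add_neg]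
  ring

open MvPolynomial in
lemma J_eq (J : MvPolynomial (Fin 2) ℂ)
    (hJ : ∀ x y : ℝ,
      MvPolynomial.eval ![(x : ℂ), (y : ℂ)] J =
        -1 + 2 * ((j9 ((x : ℂ) + (y : ℂ) * Complex.I)
          ((x : ℂ) - (y : ℂ) * Complex.I)).re : ℂ)) :
    J = gG (C bC) (C ((starRingEnd ℂ) bC)) (X 0 + X 1 * C Complex.I)
      (X 0 - X 1 * C Complex.I) := by
  refine funext_set (fun _ => Set.range ((↑) : ℝ → ℂ))
    (fun _ => Set.infinite_range_of_injective Complex.ofReal_injective) ?_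
  intro z hz
  obtain ⟨x, hx⟩ := hz 0 trivial
  obtain ⟨y, hy⟩ := hz 1 trivial
  have hz' : z = ![(x : ℂ), (y : ℂ)] := by
    ext i; fin_cases i
    · exact hx.symm
    · exact hy.symm
  rw [hz', hJ, j9_re]
  simp [gG]

open MvPolynomial in
/-- The total Milnor number of `J₉`, regarded as a polynomial in `ℂ[x,y]`, is 64: the Milnor
algebra `ℂ[x,y]/⟨∂J₉/∂x, ∂J₉/∂y⟩` has complex dimension 64. -/
theorem stmt6 (J : MvPolynomial (Fin 2) ℂ)
    (hJ : ∀ x y : ℝ,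
      MvPolynomial.eval ![(x : ℂ), (y : ℂ)] J =
        -1 + 2 * ((j9 ((x : ℂ) + (y : ℂ) * Complex.I)
          ((x : ℂ) - (y : ℂ) * Complex.I)).re : ℂ)) :
    Module.finrank ℂ
      (MvPolynomial (Fin 2) ℂ ⧸
        Ideal.span ({pderiv 0 J, pderiv 1 J} : Set (MvPolynomial (Fin 2) ℂ))) = 64 := by
  have hbc := bC_mul_conj
  rw [J_eq J hJ]
  set c := (starRingEnd ℂ) bC with hc
  rw [deriv_gG (pderiv 0) bC c hbc, deriv_gG (pderiv 1) bC c hbc]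
  have hbc' : (C bC : MvPolynomial (Fin 2) ℂ) * C c = 1 := by rw [← C_mul, hbc, C_1]
  have d1 : pderiv 0 (X 0 + X 1 * C Complex.I : MvPolynomial (Fin 2) ℂ) = 1 := by
    simp [pderiv_X]
  have d2 : pderiv 0 (X 0 - X 1 * C Complex.I : MvPolynomial (Fin 2) ℂ) = 1 := by
    simp [pderiv_X]
  have d3 : pderiv 1 (X 0 + X 1 * C Complex.I : MvPolynomial (Fin 2) ℂ) = C Complex.I := by
    simp [pderiv_X]
  have d4 : pderiv 1 (X 0 - X 1 * C Complex.I : MvPolynomial (Fin 2) ℂ) = -C Complex.I := by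
    simp [pderiv_X]
  rw [d1, d2, d3, d4]
  have hI := C_I_sq
  have h18 : (C (1 / 18) : MvPolynomial (Fin 2) ℂ) * 18 = 1 := by
    rw [← map_ofNat (C (σ := Fin 2) (R := ℂ)) 18, ← map_mul]; norm_num
  rw [← finrank_quot (pp (C c) (X 0) (X 1)) (pp (C bC) (X 1) (X 0)) (pp_mem c) (pp_mem' bC)]
  refine (Ideal.quotientEquivAlg _ _ phi ?_).toLinearEquiv.finrank_eq.symm
  rw [Ideal.map_span, Set.image_pair]
  change _ = Ideal.span {phi _, phi _}
  rw [phi_pp, phi_pp']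
  exact span_aux _ _ _ _ _ _ hbc' hI h18
end
end
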